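/- Let εₙ → 0 and βₙ → 0 with βₙ ≤ D²εₙ⁴ where D > 0 depends only on C₀, and for each n let uₙ be an admissible solution of (★) with parameters εₙ, βₙ, whose initial datum uₙ(0,·) satisfies the data bounds with constant C₀. Suppose uₙ → u strongly in L^p_loc((0,∞)×ℝ) for each 1 ≤ p < 4 and almost everywhere, where u ∈ L^∞((0,∞); L²(ℝ)∩L⁴(ℝ)). Then u satisfies the entropy inequality: for every convex η ∈ C²(ℝ) with bounded first and second derivatives, with entropy flux q(v) = ∫₀^v 2ξ η′(ξ) dξ, and every nonnegative φ ∈ C_c^∞((0,∞)×ℝ): ∫₀^∞ ∫_ℝ (η(u) ∂_tφ + q(u) ∂_xφ) dx dt ≥ 0. -/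

import Mathlib

open MeasureTheory Real Filter Set

noncomputable section

/-- `mixedD u j k t x`: `j` time derivatives of the `k`-th spatial derivative of `u` at `(t,x)`. -/
def mixedD (u : ℝ → ℝ → ℝ) (j k : ℕ) (t x : ℝ) : ℝ :=
  iteratedDeriv j (fun s => iteratedDeriv k (fun y => u s y) x) t

/-- Squared `L²` norm in the space variable. -/
def sqL2 (f : ℝ → ℝ) : ℝ := ∫ x : ℝ, (f x) ^ 2

/-- `L²` norm in the space variable. -/
def nL2 (f : ℝ → ℝ) : ℝ := Real.sqrt (∫ x : ℝ, (f x) ^ 2)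

/-- `L⁴` norm in the space variable. -/
def nL4 (f : ℝ → ℝ) : ℝ := (∫ x : ℝ, (f x) ^ 4) ^ ((1 : ℝ) / 4)

/-- Admissible solution of the Rosenau–KdV–RLW approximation (★). -/
structure IsAdmissibleKdVRLW (ε β : ℝ) (u : ℝ → ℝ → ℝ) : Prop where
  smooth : ContDiff ℝ (⊤ : ℕ∞) (fun p : ℝ × ℝ => u p.1 p.2)
  pde : ∀ t > (0 : ℝ), ∀ x : ℝ,
    mixedD u 1 0 t x + deriv (fun y => (u t y) ^ 2) x
      + β * mixedD u 0 3 t x - β * mixedD u 1 2 t x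
      + β ^ 2 * mixedD u 1 4 t x = ε * mixedD u 0 2 t x
  sq_int : ∀ T > (0 : ℝ), ∀ j k : ℕ, j + k ≤ 5 → ∀ t ∈ Set.Icc (0 : ℝ) T,
    MeasureTheory.Integrable (fun x : ℝ => (mixedD u j k t x) ^ 2)
  decay : ∀ T > (0 : ℝ), ∀ j k : ℕ, j + k ≤ 5 → ∀ δ > (0 : ℝ), ∃ M : ℝ,
    ∀ x : ℝ, M ≤ |x| → ∀ t ∈ Set.Icc (0 : ℝ) T, |mixedD u j k t x| ≤ δ

/-- Admissible solution of the Rosenau–RLW approximation (★★). -/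
structure IsAdmissibleRLW (ε β : ℝ) (u : ℝ → ℝ → ℝ) : Prop where
  smooth : ContDiff ℝ (⊤ : ℕ∞) (fun p : ℝ × ℝ => u p.1 p.2)
  pde : ∀ t > (0 : ℝ), ∀ x : ℝ,
    mixedD u 1 0 t x + deriv (fun y => (u t y) ^ 2) x
      - β * mixedD u 1 2 t x + β ^ 2 * mixedD u 1 4 t x = ε * mixedD u 0 2 t x
  sq_int : ∀ T > (0 : ℝ), ∀ j k : ℕ, j + k ≤ 5 → ∀ t ∈ Set.Icc (0 : ℝ) T,
    MeasureTheory.Integrable (fun x : ℝ => (mixedD u j k t x) ^ 2)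
  decay : ∀ T > (0 : ℝ), ∀ j k : ℕ, j + k ≤ 5 → ∀ δ > (0 : ℝ), ∃ M : ℝ,
    ∀ x : ℝ, M ≤ |x| → ∀ t ∈ Set.Icc (0 : ℝ) T, |mixedD u j k t x| ≤ δ

/-- Data bounds with constant `C0` for the (★) approximation. -/
def DataBoundsKdVRLW (ε β C0 : ℝ) (f : ℝ → ℝ) : Prop :=
  (∫ x : ℝ, (f x) ^ 2) + (∫ x : ℝ, (f x) ^ 4)
      + (β + ε ^ 2) * (∫ x : ℝ, (deriv f x) ^ 2) ≤ C0 ∧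
  (β * ε + β * ε ^ 2 + β ^ 2) * (∫ x : ℝ, (iteratedDeriv 2 f x) ^ 2)
      + (β ^ 2 * ε ^ 2 + β ^ 3) * (∫ x : ℝ, (iteratedDeriv 3 f x) ^ 2) ≤ C0 ∧
  β ^ 4 * (∫ x : ℝ, (iteratedDeriv 4 f x) ^ 2) ≤ C0

/-- Data bounds with constant `C0` for the (★★) approximation. -/
def DataBoundsRLW (ε β C0 : ℝ) (f : ℝ → ℝ) : Prop :=
  (∫ x : ℝ, (f x) ^ 2) + (∫ x : ℝ, (f x) ^ 4)
    + β * ε ^ 2 * (∫ x : ℝ, (iteratedDeriv 2 f x) ^ 2) ≤ C0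

/-- `u ∈ L^∞((0,∞); L²(ℝ) ∩ L⁴(ℝ))`. -/
def BddL2L4 (u : ℝ → ℝ → ℝ) : Prop :=
  ∃ M : ℝ, ∀ t > (0 : ℝ), (∫ x : ℝ, (u t x) ^ 2) ≤ M ∧ (∫ x : ℝ, (u t x) ^ 4) ≤ M

/-- Entropy solution of `∂ₜ u + ∂ₓ (u²) = 0` with initial datum `u0`. -/
def IsEntropySolution (u : ℝ → ℝ → ℝ) (u0 : ℝ → ℝ) : Prop :=
  ∀ η : ℝ → ℝ, ContDiff ℝ 2 η → ConvexOn ℝ Set.univ η →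
    (∃ M : ℝ, ∀ v : ℝ, |deriv η v| ≤ M) →
    ∀ φ : ℝ → ℝ → ℝ, ContDiff ℝ (⊤ : ℕ∞) (fun p : ℝ × ℝ => φ p.1 p.2) →
      HasCompactSupport (fun p : ℝ × ℝ => φ p.1 p.2) →
      (∀ t x : ℝ, 0 ≤ φ t x) →
      0 ≤ (∫ t in Set.Ioi (0 : ℝ), ∫ x : ℝ,
            (η (u t x) * deriv (fun s => φ s x) t
              + (∫ ξ in (0 : ℝ)..(u t x), 2 * ξ * deriv η ξ) * deriv (fun y => φ t y) x))
          + ∫ x : ℝ, η (u0 x) * φ 0 x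

open scoped ContDiff

lemma ContDiff.hasDerivAt_slice_left {f : ℝ × ℝ → ℝ} (hf : ContDiff ℝ ∞ f) (t x : ℝ) :
    HasDerivAt (fun s => f (s, x)) (fderiv ℝ f (t, x) (1, 0)) t := by
  have h := (hf.differentiable (by simp) (t, x)).hasFDerivAt
  exact h.comp_hasDerivAt t ((hasDerivAt_id t).prodMk (hasDerivAt_const t x))

lemma ContDiff.hasDerivAt_slice_right {f : ℝ × ℝ → ℝ} (hf : ContDiff ℝ ∞ f) (t x : ℝ) :
    HasDerivAt (fun y => f (t, y)) (fderiv ℝ f (t, x) (0, 1)) x := by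
  have h := (hf.differentiable (by simp) (t, x)).hasFDerivAt
  exact h.comp_hasDerivAt x ((hasDerivAt_const x t).prodMk (hasDerivAt_id x))

lemma ContDiff.fderiv_apply_const_infty {f : ℝ × ℝ → ℝ} (hf : ContDiff ℝ ∞ f) (v : ℝ × ℝ) :
    ContDiff ℝ ∞ (fun p => fderiv ℝ f p v) :=
  (hf.fderiv_right (m := ∞) (by simp)).clm_apply contDiff_const

lemma ContDiff.fderiv_fderiv_comm {f : ℝ × ℝ → ℝ} (hf : ContDiff ℝ ∞ f) (v w p : ℝ × ℝ) :
    fderiv ℝ (fun p => fderiv ℝ f p v) p w = fderiv ℝ (fun p => fderiv ℝ f p w) p v := by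
  have hd : DifferentiableAt ℝ (fderiv ℝ f) p :=
    (hf.fderiv_right (m := ∞) (by simp)).differentiable (by simp) p
  have h : ∀ v w : ℝ × ℝ, fderiv ℝ (fun p => fderiv ℝ f p v) p w
      = fderiv ℝ (fderiv ℝ f) p w v := by
    intro v w
    rw [fderiv_clm_apply hd (differentiableAt_const v)]
    simp
  rw [h, h]
  exact (hf.contDiffAt.isSymmSndFDerivAt (by
    rw [minSmoothness_of_isRCLikeNormedField]
    exact WithTop.coe_le_coe.2 (le_top : (2 : ℕ∞) ≤ ⊤))) w v

lemma mixedD_zero_zero (u : ℝ → ℝ → ℝ) : mixedD u 0 0 = u := by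
  funext t x; simp [mixedD]

lemma mixedD_zero_eq (u : ℝ → ℝ → ℝ) (k : ℕ) (t : ℝ) :
    mixedD u 0 k t = iteratedDeriv k (u t) := by
  funext x; simp [mixedD]

lemma mixedD_succ_left (u : ℝ → ℝ → ℝ) (j k : ℕ) (t x : ℝ) :
    mixedD u (j + 1) k t x = deriv (fun s => mixedD u j k s x) t := by
  simp only [mixedD, iteratedDeriv_succ]

lemma mixedD_zero_succ (u : ℝ → ℝ → ℝ) (k : ℕ) (t x : ℝ) :
    mixedD u 0 (k + 1) t x = deriv (fun y => mixedD u 0 k t y) x := by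
  simp only [mixedD_zero_eq, iteratedDeriv_succ]

lemma contDiff_mixedD_zero {u : ℝ → ℝ → ℝ} (hu : ContDiff ℝ ∞ (fun p : ℝ × ℝ => u p.1 p.2))
    (k : ℕ) : ContDiff ℝ ∞ (fun p : ℝ × ℝ => mixedD u 0 k p.1 p.2) := by
  induction k with
  | zero => simpa [mixedD_zero_zero] using hu
  | succ k ih =>
    convert ih.fderiv_apply_const_infty (0, 1) using 2 with p
    rw [mixedD_zero_succ]
    exact (ih.hasDerivAt_slice_right p.1 p.2).deriv

lemma contDiff_mixedD {u : ℝ → ℝ → ℝ} (hu : ContDiff ℝ ∞ (fun p : ℝ × ℝ => u p.1 p.2))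
    (j k : ℕ) : ContDiff ℝ ∞ (fun p : ℝ × ℝ => mixedD u j k p.1 p.2) := by
  induction j with
  | zero => exact contDiff_mixedD_zero hu k
  | succ j ih =>
    convert ih.fderiv_apply_const_infty (1, 0) using 2 with p
    rw [mixedD_succ_left]
    exact (ih.hasDerivAt_slice_left p.1 p.2).deriv

lemma continuous_mixedD {u : ℝ → ℝ → ℝ} (hu : ContDiff ℝ ∞ (fun p : ℝ × ℝ => u p.1 p.2))
    (j k : ℕ) : Continuous (fun p : ℝ × ℝ => mixedD u j k p.1 p.2) :=
  (contDiff_mixedD hu j k).continuous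

lemma hasDerivAt_mixedD_left {u : ℝ → ℝ → ℝ} (hu : ContDiff ℝ ∞ (fun p : ℝ × ℝ => u p.1 p.2))
    (j k : ℕ) (t x : ℝ) :
    HasDerivAt (fun s => mixedD u j k s x) (mixedD u (j + 1) k t x) t := by
  rw [mixedD_succ_left]
  exact ((contDiff_mixedD hu j k).hasDerivAt_slice_left t x).differentiableAt.hasDerivAt

lemma mixedD_succ_right {u : ℝ → ℝ → ℝ} (hu : ContDiff ℝ ∞ (fun p : ℝ × ℝ => u p.1 p.2))
    (j k : ℕ) (t x : ℝ) :
    mixedD u j (k + 1) t x = deriv (fun y => mixedD u j k t y) x := by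
  induction j generalizing t x with
  | zero => exact mixedD_zero_succ u k t x
  | succ j ih =>
    have hs := contDiff_mixedD hu j k
    have h1 : ∀ t x, mixedD u (j + 1) k t x
        = fderiv ℝ (fun p : ℝ × ℝ => mixedD u j k p.1 p.2) (t, x) (1, 0) := fun t x => by
      rw [mixedD_succ_left]; exact (hs.hasDerivAt_slice_left t x).deriv
    have h2 : ∀ t x, mixedD u j (k + 1) t x
        = fderiv ℝ (fun p : ℝ × ℝ => mixedD u j k p.1 p.2) (t, x) (0, 1) := fun t x => by
      rw [ih]; exact (hs.hasDerivAt_slice_right t x).deriv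
    rw [mixedD_succ_left]
    simp only [h1, h2]
    rw [((hs.fderiv_apply_const_infty (0, 1)).hasDerivAt_slice_left t x).deriv,
      ((hs.fderiv_apply_const_infty (1, 0)).hasDerivAt_slice_right t x).deriv]
    exact hs.fderiv_fderiv_comm _ _ _

lemma hasDerivAt_mixedD_right {u : ℝ → ℝ → ℝ} (hu : ContDiff ℝ ∞ (fun p : ℝ × ℝ => u p.1 p.2))
    (j k : ℕ) (t x : ℝ) :
    HasDerivAt (fun y => mixedD u j k t y) (mixedD u j (k + 1) t x) x := by
  rw [mixedD_succ_right hu]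
  exact ((contDiff_mixedD hu j k).hasDerivAt_slice_right t x).differentiableAt.hasDerivAt

/-- Differentiation under an integral over a compact interval. -/
lemma hasDerivAt_intervalIntegral_of_continuous {f f' : ℝ → ℝ → ℝ}
    (hf : Continuous (fun p : ℝ × ℝ => f p.1 p.2))
    (hf' : Continuous (fun p : ℝ × ℝ => f' p.1 p.2))
    (hd : ∀ t x, HasDerivAt (fun s => f s x) (f' t x) t) (a b t : ℝ) :
    HasDerivAt (fun s => ∫ x in a..b, f s x) (∫ x in a..b, f' t x) t := by
  obtain ⟨C, hC⟩ := ((isCompact_Icc (a := t - 1) (b := t + 1)).prod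
    (isCompact_uIcc (a := a) (b := b))).exists_bound_of_continuousOn hf'.continuousOn
  refine (intervalIntegral.hasDerivAt_integral_of_dominated_loc_of_deriv_le
    (bound := fun _ => C) (s := Icc (t - 1) (t + 1))
    (Icc_mem_nhds (by linarith) (by linarith)) ?_ ?_ ?_ ?_ ?_ ?_).2
  · exact .of_forall fun s => (by fun_prop : Continuous (fun x => f s x)).aestronglyMeasurable
  · exact (by fun_prop : Continuous (fun x => f t x)).intervalIntegrable _ _
  · exact (by fun_prop : Continuous (fun x => f' t x)).aestronglyMeasurable
  · exact .of_forall fun x hx s hs => hC (s, x) ⟨hs, uIoc_subset_uIcc hx⟩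
  · simp
  · exact .of_forall fun x _ s _ => hd s x

/-- Decay at spatial infinity, uniformly on bounded time intervals. -/
def DecaysUniformly (g : ℝ → ℝ → ℝ) : Prop :=
  ∀ T > (0 : ℝ), ∀ δ > (0 : ℝ), ∃ M : ℝ, ∀ x : ℝ, M ≤ |x| → ∀ t ∈ Icc (0 : ℝ) T, |g t x| ≤ δ

namespace DecaysUniformly

variable {f g : ℝ → ℝ → ℝ}

lemma add (hf : DecaysUniformly f) (hg : DecaysUniformly g) :
    DecaysUniformly (fun t x => f t x + g t x) := by
  intro T hT δ hδ
  obtain ⟨M, hM⟩ := hf T hT (δ / 2) (by positivity)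
  obtain ⟨N, hN⟩ := hg T hT (δ / 2) (by positivity)
  refine ⟨max M N, fun x hx t ht => ?_⟩
  have h1 := hM x ((le_max_left _ _).trans hx) t ht
  have h2 := hN x ((le_max_right _ _).trans hx) t ht
  exact (abs_add_le _ _).trans (by linarith)

lemma mul (hf : DecaysUniformly f) (hg : DecaysUniformly g) :
    DecaysUniformly (fun t x => f t x * g t x) := by
  intro T hT δ hδ
  obtain ⟨M, hM⟩ := hf T hT δ hδ
  obtain ⟨N, hN⟩ := hg T hT 1 one_pos
  refine ⟨max M N, fun x hx t ht => ?_⟩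
  have h1 := hM x ((le_max_left _ _).trans hx) t ht
  have h2 := hN x ((le_max_right _ _).trans hx) t ht
  rw [abs_mul]
  nlinarith [abs_nonneg (f t x), abs_nonneg (g t x)]

lemma const_mul (hf : DecaysUniformly f) (c : ℝ) :
    DecaysUniformly (fun t x => c * f t x) := by
  intro T hT δ hδ
  obtain ⟨M, hM⟩ := hf T hT (δ / (|c| + 1)) (by positivity)
  refine ⟨M, fun x hx t ht => ?_⟩
  have h1 := hM x hx t ht
  rw [le_div_iff₀ (by positivity)] at h1
  rw [abs_mul]
  nlinarith [abs_nonneg (f t x), abs_nonneg c]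

lemma sub (hf : DecaysUniformly f) (hg : DecaysUniformly g) :
    DecaysUniformly (fun t x => f t x - g t x) := by
  simpa [sub_eq_add_neg] using hf.add (hg.const_mul (-1))

lemma pow (hf : DecaysUniformly f) {n : ℕ} (hn : n ≠ 0) :
    DecaysUniformly (fun t x => f t x ^ n) := by
  induction n with
  | zero => exact absurd rfl hn
  | succ n ih =>
    rcases eq_or_ne n 0 with rfl | h
    · simpa using hf
    · simpa [pow_succ] using (ih h).mul hf

end DecaysUniformly

namespace IsAdmissibleKdVRLW

variable {ε β : ℝ} {u : ℝ → ℝ → ℝ}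

lemma decays (h : IsAdmissibleKdVRLW ε β u) {j k : ℕ} (hjk : j + k ≤ 5) :
    DecaysUniformly (mixedD u j k) := fun T hT => h.decay T hT j k hjk

lemma pde_nonneg (h : IsAdmissibleKdVRLW ε β u) {t : ℝ} (ht : 0 ≤ t) (x : ℝ) :
    mixedD u 1 0 t x + 2 * mixedD u 0 0 t x * mixedD u 0 1 t x
      + β * mixedD u 0 3 t x - β * mixedD u 1 2 t x
      + β ^ 2 * mixedD u 1 4 t x = ε * mixedD u 0 2 t x := by
  have hc : ∀ j k, Continuous (fun t => mixedD u j k t x) := fun j k =>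
    (continuous_mixedD h.smooth j k).comp (by fun_prop : Continuous (fun t : ℝ => (t, x)))
  have key : Icc 0 (t + 1) ⊆ {t | mixedD u 1 0 t x + 2 * mixedD u 0 0 t x * mixedD u 0 1 t x
      + β * mixedD u 0 3 t x - β * mixedD u 1 2 t x
      + β ^ 2 * mixedD u 1 4 t x = ε * mixedD u 0 2 t x} := by
    rw [← closure_Ioo (by linarith : (0 : ℝ) ≠ t + 1)]
    refine closure_minimal ?_ (isClosed_eq (by fun_prop) (by fun_prop))
    intro s hs
    have h1 := h.pde s hs.1 x
    have h2 : deriv (fun y => (u s y) ^ 2) x = 2 * mixedD u 0 0 s x * mixedD u 0 1 s x := by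
      simpa [mixedD_zero_zero] using ((hasDerivAt_mixedD_right h.smooth 0 0 s x).fun_pow 2).deriv
    simpa [h2] using h1
  exact key ⟨ht, by linarith⟩

/-- Flux of the `L²`-type energy. -/
def energyFlux (ε β : ℝ) (u : ℝ → ℝ → ℝ) (t x : ℝ) : ℝ :=
  -(4 / 3) * mixedD u 0 0 t x ^ 3
    - 2 * β * (mixedD u 0 0 t x * mixedD u 0 2 t x) + β * mixedD u 0 1 t x ^ 2
    + 2 * β * (mixedD u 0 0 t x * mixedD u 1 1 t x)
    - 2 * β ^ 2 * (mixedD u 0 0 t x * mixedD u 1 3 t x)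
    + 2 * β ^ 2 * (mixedD u 0 1 t x * mixedD u 1 2 t x)
    + 2 * ε * (mixedD u 0 0 t x * mixedD u 0 1 t x)

/-- Flux of the higher-order energy. -/
def higherFlux (ε β : ℝ) (u : ℝ → ℝ → ℝ) (t x : ℝ) : ℝ :=
  -(4 / 5) * mixedD u 0 0 t x ^ 5
    - 2 * β * (mixedD u 0 0 t x ^ 3 * mixedD u 0 2 t x)
    + 2 * β * (mixedD u 0 0 t x ^ 3 * mixedD u 1 1 t x)
    - 2 * β ^ 2 * (mixedD u 0 0 t x ^ 3 * mixedD u 1 3 t x)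
    + 6 * β ^ 2 * (mixedD u 0 0 t x ^ 2 * mixedD u 0 1 t x * mixedD u 1 2 t x)
    + 2 * ε * (mixedD u 0 0 t x ^ 3 * mixedD u 0 1 t x)
    + 2 * ε ^ 2 * (mixedD u 0 1 t x * mixedD u 1 0 t x)
    + ε ^ 2 * β / 2 * mixedD u 0 2 t x ^ 2
    + ε ^ 2 * β ^ 2 * (mixedD u 0 2 t x * mixedD u 1 3 t x)
    - ε * β * (mixedD u 0 2 t x * mixedD u 1 0 t x)
    + ε * β * (mixedD u 1 0 t x * mixedD u 1 1 t x)
    - ε * β ^ 2 * (mixedD u 1 0 t x * mixedD u 1 3 t x)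
    + ε * β ^ 2 * (mixedD u 1 1 t x * mixedD u 1 2 t x)

lemma decays_energyFlux (h : IsAdmissibleKdVRLW ε β u) :
    DecaysUniformly (energyFlux ε β u) := by
  have d : ∀ {j k : ℕ}, j + k ≤ 5 → DecaysUniformly (mixedD u j k) := h.decays
  unfold energyFlux
  repeat' first
    | exact d (by norm_num)
    | apply DecaysUniformly.sub
    | apply DecaysUniformly.add
    | apply DecaysUniformly.const_mul
    | exact (d (by norm_num)).pow (by norm_num)
    | apply DecaysUniformly.mul

lemma decays_higherFlux (h : IsAdmissibleKdVRLW ε β u) :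
    DecaysUniformly (higherFlux ε β u) := by
  have d : ∀ {j k : ℕ}, j + k ≤ 5 → DecaysUniformly (mixedD u j k) := h.decays
  unfold higherFlux
  repeat' first
    | exact d (by norm_num)
    | apply DecaysUniformly.sub
    | apply DecaysUniformly.add
    | apply DecaysUniformly.const_mul
    | exact (d (by norm_num)).pow (by norm_num)
    | apply DecaysUniformly.mul

lemma hasDerivAt_energyFlux (h : IsAdmissibleKdVRLW ε β u) {t : ℝ} (ht : 0 ≤ t) (x : ℝ) :
    HasDerivAt (energyFlux ε β u t)
      (2 * mixedD u 0 0 t x * mixedD u 1 0 t x + β * (2 * mixedD u 0 1 t x * mixedD u 1 1 t x)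
        + β ^ 2 * (2 * mixedD u 0 2 t x * mixedD u 1 2 t x)
        + 2 * ε * mixedD u 0 1 t x ^ 2) x := by
  have d : ∀ j k, HasDerivAt (fun y => mixedD u j k t y) (mixedD u j (k + 1) t x) x :=
    fun j k => hasDerivAt_mixedD_right h.smooth j k t x
  have hp := h.pde_nonneg ht x
  have key := ((((((((d 0 0).pow 3).const_mul (-(4 / 3))).sub
    (((d 0 0).mul (d 0 2)).const_mul (2 * β))).add (((d 0 1).pow 2).const_mul β)).add
    (((d 0 0).mul (d 1 1)).const_mul (2 * β))).sub
    (((d 0 0).mul (d 1 3)).const_mul (2 * β ^ 2))).add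
    (((d 0 1).mul (d 1 2)).const_mul (2 * β ^ 2))).add
    (((d 0 0).mul (d 0 1)).const_mul (2 * ε))
  refine HasDerivAt.congr_deriv (f := energyFlux ε β u t) key ?_
  simp only [Nat.reduceAdd, Nat.cast_ofNat, Nat.reduceSub]
  linear_combination (-2 * mixedD u 0 0 t x) * hp

lemma hasDerivAt_higherFlux (h : IsAdmissibleKdVRLW ε β u) {t : ℝ} (ht : 0 ≤ t) (x : ℝ) :
    HasDerivAt (higherFlux ε β u t)
      ((2 * mixedD u 0 0 t x ^ 3 * mixedD u 1 0 t x
        + ε ^ 2 * (2 * mixedD u 0 1 t x * mixedD u 1 1 t x)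
        + ε ^ 2 / 2 * (β * (2 * mixedD u 0 2 t x * mixedD u 1 2 t x)
          + β ^ 2 * (2 * mixedD u 0 3 t x * mixedD u 1 3 t x)))
        + (6 * ε * (mixedD u 0 0 t x * mixedD u 0 1 t x) ^ 2 + ε ^ 3 * mixedD u 0 2 t x ^ 2
          + ε * mixedD u 1 0 t x ^ 2 + ε * β * mixedD u 1 1 t x ^ 2
          + ε * β ^ 2 * mixedD u 1 2 t x ^ 2)
        - (6 * β * mixedD u 0 0 t x ^ 2 * mixedD u 0 1 t x * mixedD u 0 2 t x
          - 6 * β * mixedD u 0 0 t x ^ 2 * mixedD u 0 1 t x * mixedD u 1 1 t x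
          - 2 * β ^ 2 * (6 * mixedD u 0 0 t x * mixedD u 0 1 t x ^ 2
            + 3 * mixedD u 0 0 t x ^ 2 * mixedD u 0 2 t x) * mixedD u 1 2 t x
          + 2 * ε ^ 2 * mixedD u 0 0 t x * mixedD u 0 1 t x * mixedD u 0 2 t x
          - 2 * ε * mixedD u 0 0 t x * mixedD u 0 1 t x * mixedD u 1 0 t x
          + ε * β * mixedD u 0 2 t x * mixedD u 1 1 t x)) x := by
  have d : ∀ j k, HasDerivAt (fun y => mixedD u j k t y) (mixedD u j (k + 1) t x) x :=
    fun j k => hasDerivAt_mixedD_right h.smooth j k t x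
  have hp := h.pde_nonneg ht x
  have key := ((((((((((((((d 0 0).pow 5).const_mul (-(4 / 5))).sub
    ((((d 0 0).pow 3).mul (d 0 2)).const_mul (2 * β))).add
    ((((d 0 0).pow 3).mul (d 1 1)).const_mul (2 * β))).sub
    ((((d 0 0).pow 3).mul (d 1 3)).const_mul (2 * β ^ 2))).add
    (((((d 0 0).pow 2).mul (d 0 1)).mul (d 1 2)).const_mul (6 * β ^ 2))).add
    ((((d 0 0).pow 3).mul (d 0 1)).const_mul (2 * ε))).add
    (((d 0 1).mul (d 1 0)).const_mul (2 * ε ^ 2))).add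
    (((d 0 2).pow 2).const_mul (ε ^ 2 * β / 2))).add
    (((d 0 2).mul (d 1 3)).const_mul (ε ^ 2 * β ^ 2))).sub
    (((d 0 2).mul (d 1 0)).const_mul (ε * β))).add
    (((d 1 0).mul (d 1 1)).const_mul (ε * β))).sub
    (((d 1 0).mul (d 1 3)).const_mul (ε * β ^ 2))).add
    (((d 1 1).mul (d 1 2)).const_mul (ε * β ^ 2))
  refine HasDerivAt.congr_deriv (f := higherFlux ε β u t) key ?_
  simp only [Nat.reduceAdd, Nat.cast_ofNat, Nat.reduceSub, Pi.pow_apply, Pi.mul_apply]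
  linear_combination (-2 * mixedD u 0 0 t x ^ 3 + ε ^ 2 * mixedD u 0 2 t x
    - ε * mixedD u 1 0 t x) * hp

end IsAdmissibleKdVRLW

/-- One-dimensional Sobolev inequality on a symmetric interval. -/
lemma sq_le_add_integral_sq {f f' : ℝ → ℝ} (hf : ∀ x, HasDerivAt f (f' x) x)
    (hf' : Continuous f') {R x l : ℝ} (hx : x ∈ Icc (-R) R) (hl : 0 < l) :
    f x ^ 2 ≤ f R ^ 2 + (l⁻¹ * ∫ y in (-R)..R, f y ^ 2) + l * ∫ y in (-R)..R, f' y ^ 2 := by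
  have hc : Continuous f := continuous_iff_continuousAt.2 fun x => (hf x).continuousAt
  have h1 : ∫ y in x..R, 2 * f y * f' y = f R ^ 2 - f x ^ 2 := by
    refine intervalIntegral.integral_eq_sub_of_hasDerivAt (f := fun y => f y ^ 2) (fun y _ => ?_)
      ((by fun_prop : Continuous (fun y => 2 * f y * f' y)).intervalIntegrable _ _)
    simpa using (hf y).fun_pow 2
  have h2 : -(∫ y in x..R, 2 * f y * f' y) ≤ ∫ y in x..R, (l⁻¹ * f y ^ 2 + l * f' y ^ 2) := by
    rw [← intervalIntegral.integral_neg]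
    refine intervalIntegral.integral_mono_on hx.2
      ((by fun_prop : Continuous _).intervalIntegrable _ _)
      ((by fun_prop : Continuous _).intervalIntegrable _ _) fun y _ => ?_
    have : 0 ≤ l⁻¹ * (f y + l * f' y) ^ 2 := by positivity
    have e : l⁻¹ * (f y + l * f' y) ^ 2 = l⁻¹ * f y ^ 2 + 2 * f y * f' y + l * f' y ^ 2 := by
      field_simp
      ring
    linarith
  rw [h1] at h2
  have h3 : ∫ y in x..R, (l⁻¹ * f y ^ 2 + l * f' y ^ 2)
      ≤ ∫ y in (-R)..R, (l⁻¹ * f y ^ 2 + l * f' y ^ 2) := by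
    refine intervalIntegral.integral_mono_interval hx.1 hx.2 le_rfl
      (.of_forall fun y => by positivity)
      ((by fun_prop : Continuous _).intervalIntegrable _ _)
  have h4 := h2.trans h3
  rw [intervalIntegral.integral_add
    ((by fun_prop : Continuous _).intervalIntegrable _ _)
    ((by fun_prop : Continuous _).intervalIntegrable _ _),
    intervalIntegral.integral_const_mul, intervalIntegral.integral_const_mul] at h4
  linarith

lemma mul_mul_le_of_abs_le {k K : ℝ} (h : |k| ≤ K) (x y : ℝ) : k * x * y ≤ K * |x| * |y| := by
  calc k * x * y ≤ |k * x * y| := le_abs_self _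
    _ = |k| * (|x| * |y|) := by rw [abs_mul, abs_mul, mul_assoc]
    _ ≤ K * (|x| * |y|) := by gcongr
    _ = _ := by ring

/-- The bad terms in the higher-order energy balance are absorbed by the dissipation. -/
lemma higher_bulk_le {ε σ u p r a b c : ℝ} (hε : 0 < ε) (hσ : 0 ≤ σ)
    (h1 : |σ * u| ≤ ε / 100) (h2 : |σ ^ 2 * p| ≤ ε / 100) (h3 : σ ≤ ε / 100) :
    6 * σ ^ 2 * u ^ 2 * p * r - 6 * σ ^ 2 * u ^ 2 * p * b
        - 2 * (σ ^ 2) ^ 2 * (6 * u * p ^ 2 + 3 * u ^ 2 * r) * c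
        + 2 * ε ^ 2 * u * p * r - 2 * ε * u * p * a + ε * σ ^ 2 * r * b
      ≤ 23 / 4 * ε * (u * p) ^ 2 + 3 / 4 * (ε ^ 3 * r ^ 2 + ε * a ^ 2 + ε * σ ^ 2 * b ^ 2
        + ε * (σ ^ 2) ^ 2 * c ^ 2) := by
  have h3' : |σ| ≤ ε / 100 := by rwa [abs_of_nonneg hσ]
  have t1 := mul_mul_le_of_abs_le (k := 6 * (σ * u) * σ) (K := 6 * (ε / 100) * (ε / 100))
    (by rw [abs_mul, abs_mul, abs_of_pos (by norm_num : (0 : ℝ) < 6)]; gcongr) (u * p) r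
  have t2 := mul_mul_le_of_abs_le (k := -(6 * (σ * u))) (K := 6 * (ε / 100))
    (by rw [abs_neg, abs_mul, abs_of_pos (by norm_num : (0 : ℝ) < 6)]; gcongr) (u * p) (σ * b)
  have t3 := mul_mul_le_of_abs_le (k := -(12 * (σ ^ 2 * p))) (K := 12 * (ε / 100))
    (by rw [abs_neg, abs_mul, abs_of_pos (by norm_num : (0 : ℝ) < 12)]; gcongr)
    (u * p) (σ ^ 2 * c)
  have t4 := mul_mul_le_of_abs_le (k := -(6 * (σ * u) * (σ * u)))
    (K := 6 * (ε / 100) * (ε / 100))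
    (by rw [abs_neg, abs_mul, abs_mul, abs_of_pos (by norm_num : (0 : ℝ) < 6)]; gcongr)
    r (σ ^ 2 * c)
  have t5 := mul_mul_le_of_abs_le (k := 2 * ε ^ 2) (K := 2 * ε ^ 2)
    (abs_of_pos (by positivity)).le (u * p) r
  have t6 := mul_mul_le_of_abs_le (k := -(2 * ε)) (K := 2 * ε)
    (by rw [abs_neg, abs_of_pos (by positivity)]) (u * p) a
  have t7 := mul_mul_le_of_abs_le (k := ε * σ) (K := ε * (ε / 100))
    (by rw [abs_mul, abs_of_pos hε]; gcongr) r (σ * b)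
  have key : ∀ Y S A B K : ℝ,
      6 / 10000 * Y * S + 6 / 100 * Y * B + 12 / 100 * Y * K + 6 / 10000 * S * K
        + 2 * Y * S + 2 * Y * A + 1 / 100 * S * B
      ≤ 23 / 4 * Y ^ 2 + 3 / 4 * (S ^ 2 + A ^ 2 + B ^ 2 + K ^ 2) := by
    intro Y S A B K
    linarith [sq_nonneg (8 * Y - 5 * S), sq_nonneg (8 * Y - 5 * A), sq_nonneg (Y - B),
      sq_nonneg (Y - K), sq_nonneg (S - K), sq_nonneg (S - B), sq_nonneg (Y - S),
      sq_nonneg Y, sq_nonneg S, sq_nonneg A, sq_nonneg B, sq_nonneg K]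
  have hk := mul_le_mul_of_nonneg_left
    (key |u * p| (ε * |r|) |a| |σ * b| |σ ^ 2 * c|) hε.le
  rw [mul_pow, sq_abs, sq_abs, sq_abs, sq_abs, sq_abs] at hk
  linarith

/-- Localized `L²`-type energy. -/
def localEnergy (β : ℝ) (u : ℝ → ℝ → ℝ) (R t : ℝ) : ℝ :=
  ∫ x in (-R)..R, (mixedD u 0 0 t x ^ 2 + β * mixedD u 0 1 t x ^ 2 + β ^ 2 * mixedD u 0 2 t x ^ 2)

/-- Localized higher-order energy. -/
def localHigher (ε β : ℝ) (u : ℝ → ℝ → ℝ) (R t : ℝ) : ℝ :=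
  ∫ x in (-R)..R, (1 / 2 * mixedD u 0 0 t x ^ 4 + ε ^ 2 * mixedD u 0 1 t x ^ 2
    + ε ^ 2 / 2 * (β * mixedD u 0 2 t x ^ 2 + β ^ 2 * mixedD u 0 3 t x ^ 2))

/-- Dissipation density of the higher-order energy. -/
def dissipation (ε β : ℝ) (u : ℝ → ℝ → ℝ) (t x : ℝ) : ℝ :=
  ε * (mixedD u 0 0 t x * mixedD u 0 1 t x) ^ 2 + ε ^ 3 * mixedD u 0 2 t x ^ 2
    + ε * mixedD u 1 0 t x ^ 2 + ε * β * mixedD u 1 1 t x ^ 2 + ε * β ^ 2 * mixedD u 1 2 t x ^ 2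

namespace IsAdmissibleKdVRLW

variable {ε β : ℝ} {u : ℝ → ℝ → ℝ}

lemma continuous_slice (h : IsAdmissibleKdVRLW ε β u) (j k : ℕ) (t : ℝ) :
    Continuous (fun x => mixedD u j k t x) :=
  (continuous_mixedD h.smooth j k).comp (by fun_prop : Continuous (fun x : ℝ => (t, x)))

lemma continuous_dissipation (h : IsAdmissibleKdVRLW ε β u) :
    Continuous (fun p : ℝ × ℝ => dissipation ε β u p.1 p.2) := by
  have hc := continuous_mixedD h.smooth
  unfold dissipation
  fun_prop

lemma hasDerivAt_localEnergy (h : IsAdmissibleKdVRLW ε β u) (R : ℝ) {t : ℝ} (ht : 0 ≤ t) :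
    HasDerivAt (localEnergy β u R) (energyFlux ε β u t R - energyFlux ε β u t (-R)
      - 2 * ε * ∫ x in (-R)..R, mixedD u 0 1 t x ^ 2) t := by
  have hc := continuous_mixedD h.smooth
  have hs := fun j k => h.continuous_slice j k t
  have key := hasDerivAt_intervalIntegral_of_continuous
    (f := fun t x => mixedD u 0 0 t x ^ 2 + β * mixedD u 0 1 t x ^ 2 + β ^ 2 * mixedD u 0 2 t x ^ 2)
    (f' := fun t x => 2 * mixedD u 0 0 t x * mixedD u 1 0 t x
      + β * (2 * mixedD u 0 1 t x * mixedD u 1 1 t x)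
      + β ^ 2 * (2 * mixedD u 0 2 t x * mixedD u 1 2 t x))
    (by fun_prop) (by fun_prop) (fun t x => by
      have d := fun j k => hasDerivAt_mixedD_left h.smooth j k t x
      refine ((((d 0 0).pow 2).add (((d 0 1).pow 2).const_mul β)).add
        (((d 0 2).pow 2).const_mul (β ^ 2))).congr_deriv ?_
      simp) (-R) R t
  refine HasDerivAt.congr_deriv (f := localEnergy β u R) key ?_
  have hF := intervalIntegral.integral_eq_sub_of_hasDerivAt (a := -R) (b := R)
    (fun x _ => h.hasDerivAt_energyFlux ht x)
    ((by fun_prop : Continuous _).intervalIntegrable _ _)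
  rw [← hF, ← intervalIntegral.integral_const_mul, ← intervalIntegral.integral_sub]
  · exact intervalIntegral.integral_congr fun x _ => by ring
  · exact (by fun_prop : Continuous _).intervalIntegrable _ _
  · exact (by fun_prop : Continuous _).intervalIntegrable _ _

/-- Time derivative density of the higher-order energy. -/
def higherRate (ε β : ℝ) (u : ℝ → ℝ → ℝ) (t x : ℝ) : ℝ :=
  2 * mixedD u 0 0 t x ^ 3 * mixedD u 1 0 t x
    + ε ^ 2 * (2 * mixedD u 0 1 t x * mixedD u 1 1 t x)
    + ε ^ 2 / 2 * (β * (2 * mixedD u 0 2 t x * mixedD u 1 2 t x)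
      + β ^ 2 * (2 * mixedD u 0 3 t x * mixedD u 1 3 t x))

lemma continuous_higherRate (h : IsAdmissibleKdVRLW ε β u) :
    Continuous (fun p : ℝ × ℝ => higherRate ε β u p.1 p.2) := by
  have hc := continuous_mixedD h.smooth
  unfold higherRate
  fun_prop

lemma hasDerivAt_localHigher (h : IsAdmissibleKdVRLW ε β u) (R t : ℝ) :
    HasDerivAt (localHigher ε β u R) (∫ x in (-R)..R, higherRate ε β u t x) t := by
  have hc := continuous_mixedD h.smooth
  refine hasDerivAt_intervalIntegral_of_continuous
    (f := fun t x => 1 / 2 * mixedD u 0 0 t x ^ 4 + ε ^ 2 * mixedD u 0 1 t x ^ 2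
      + ε ^ 2 / 2 * (β * mixedD u 0 2 t x ^ 2 + β ^ 2 * mixedD u 0 3 t x ^ 2))
    (by fun_prop) h.continuous_higherRate (fun t x => ?_) (-R) R t
  have d := fun j k => hasDerivAt_mixedD_left h.smooth j k t x
  refine (((((d 0 0).pow 4).const_mul (1 / 2)).add (((d 0 1).pow 2).const_mul (ε ^ 2))).add
    (((((d 0 2).pow 2).const_mul β).add (((d 0 3).pow 2).const_mul (β ^ 2))).const_mul
      (ε ^ 2 / 2))).congr_deriv ?_
  simp only [Nat.cast_ofNat, Nat.reduceSub, higherRate]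
  ring

lemma integral_higherRate_le (h : IsAdmissibleKdVRLW ε β u) (hε : 0 < ε)
    (hβ : 0 < β) {R : ℝ} (hR : 0 ≤ R) {t : ℝ} (ht : 0 ≤ t)
    (h1 : ∀ x ∈ Icc (-R) R, β * mixedD u 0 0 t x ^ 2 ≤ (ε / 100) ^ 2)
    (h2 : ∀ x ∈ Icc (-R) R, β ^ 2 * mixedD u 0 1 t x ^ 2 ≤ (ε / 100) ^ 2)
    (h3 : β ≤ (ε / 100) ^ 2) :
    ∫ x in (-R)..R, higherRate ε β u t x
      ≤ higherFlux ε β u t R - higherFlux ε β u t (-R)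
        - 1 / 4 * ∫ x in (-R)..R, dissipation ε β u t x := by
  have hs := fun j k => h.continuous_slice j k t
  have hF := intervalIntegral.integral_eq_sub_of_hasDerivAt (a := -R) (b := R)
    (fun x _ => h.hasDerivAt_higherFlux ht x)
    ((by fun_prop : Continuous _).intervalIntegrable _ _)
  rw [← hF, ← intervalIntegral.integral_const_mul, ← intervalIntegral.integral_sub]
  rotate_left
  · exact (by fun_prop : Continuous _).intervalIntegrable _ _
  · unfold dissipation
    exact (by fun_prop : Continuous _).intervalIntegrable _ _
  refine intervalIntegral.integral_mono_on (by linarith) ?_ ?_ fun x hx => ?_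
  · unfold higherRate
    exact (by fun_prop : Continuous _).intervalIntegrable _ _
  · unfold dissipation
    exact (by fun_prop : Continuous _).intervalIntegrable _ _
  have hσ : √β ^ 2 = β := Real.sq_sqrt hβ.le
  have key := higher_bulk_le (u := mixedD u 0 0 t x) (p := mixedD u 0 1 t x)
    (r := mixedD u 0 2 t x) (a := mixedD u 1 0 t x) (b := mixedD u 1 1 t x)
    (c := mixedD u 1 2 t x) hε (Real.sqrt_nonneg β)
    (abs_le_of_sq_le_sq (by rw [mul_pow, hσ]; exact h1 x hx) (by positivity))
    (abs_le_of_sq_le_sq (by rw [mul_pow, hσ]; exact h2 x hx) (by positivity))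
    (by rw [Real.sqrt_le_left (by positivity)]; exact h3)
  rw [hσ] at key
  simp only [higherRate, dissipation]
  linarith

lemma slice_bounds (h : IsAdmissibleKdVRLW ε β u) (hε : 0 < ε) (hβ : 0 < β) {R : ℝ} (hR : 0 ≤ R)
    {t L : ℝ} (hE : localEnergy β u R t ≤ L) (hF : localHigher ε β u R t ≤ L) :
    (∫ x in (-R)..R, mixedD u 0 0 t x ^ 2) ≤ L ∧
    ε ^ 2 * (∫ x in (-R)..R, mixedD u 0 1 t x ^ 2) ≤ L ∧
    β ^ 2 * (∫ x in (-R)..R, mixedD u 0 2 t x ^ 2) ≤ L := by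
  have hs := fun j k => h.continuous_slice j k t
  have hR' : -R ≤ R := by linarith
  refine ⟨le_trans ?_ hE, le_trans ?_ hF, le_trans ?_ hE⟩
  · refine intervalIntegral.integral_mono_on hR'
      ((by fun_prop : Continuous _).intervalIntegrable _ _)
      ((by fun_prop : Continuous _).intervalIntegrable _ _) fun x _ => ?_
    have : 0 ≤ β * mixedD u 0 1 t x ^ 2 := by positivity
    have : 0 ≤ β ^ 2 * mixedD u 0 2 t x ^ 2 := by positivity
    linarith
  · rw [← intervalIntegral.integral_const_mul]
    refine intervalIntegral.integral_mono_on hR'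
      ((by fun_prop : Continuous _).intervalIntegrable _ _)
      ((by fun_prop : Continuous _).intervalIntegrable _ _) fun x _ => ?_
    have : 0 ≤ 1 / 2 * mixedD u 0 0 t x ^ 4 := by positivity
    have : 0 ≤ ε ^ 2 / 2 * (β * mixedD u 0 2 t x ^ 2 + β ^ 2 * mixedD u 0 3 t x ^ 2) := by
      positivity
    linarith
  · rw [← intervalIntegral.integral_const_mul]
    refine intervalIntegral.integral_mono_on hR'
      ((by fun_prop : Continuous _).intervalIntegrable _ _)
      ((by fun_prop : Continuous _).intervalIntegrable _ _) fun x _ => ?_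
    have : 0 ≤ β * mixedD u 0 1 t x ^ 2 := by positivity
    have : 0 ≤ mixedD u 0 0 t x ^ 2 := by positivity
    linarith

lemma pointwise_bounds (h : IsAdmissibleKdVRLW ε β u) (hε : 0 < ε) (hβ : 0 < β) {R : ℝ}
    (hR : 0 ≤ R) {t L : ℝ} (hE : localEnergy β u R t ≤ L) (hF : localHigher ε β u R t ≤ L)
    (h0 : |mixedD u 0 0 t R| ≤ 1) (h1 : |mixedD u 0 1 t R| ≤ 1) {x : ℝ} (hx : x ∈ Icc (-R) R) :
    mixedD u 0 0 t x ^ 2 ≤ 1 + 2 * L / ε ∧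
      β ^ 2 * mixedD u 0 1 t x ^ 2 ≤ β ^ 2 + 2 * L * β / ε := by
  obtain ⟨b0, b1, b2⟩ := h.slice_bounds hε hβ hR hE hF
  have hs := fun j k => h.continuous_slice j k t
  have d := fun j k x => hasDerivAt_mixedD_right h.smooth j k t x
  have s0 := sq_le_add_integral_sq (d 0 0) (hs 0 1) hx hε
  have s1 := sq_le_add_integral_sq (d 0 1) (hs 0 2) hx (div_pos hβ hε)
  have h0' : mixedD u 0 0 t R ^ 2 ≤ 1 := (sq_le_one_iff_abs_le_one _).2 h0
  have h1' : mixedD u 0 1 t R ^ 2 ≤ 1 := (sq_le_one_iff_abs_le_one _).2 h1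
  have hεi : 0 ≤ ε⁻¹ := (inv_pos.2 hε).le
  constructor
  · have e1 := mul_le_mul_of_nonneg_left b0 hεi
    have e2 := mul_le_mul_of_nonneg_left b1 hεi
    have e3 : ε⁻¹ * (ε ^ 2 * ∫ x in (-R)..R, mixedD u 0 1 t x ^ 2)
        = ε * ∫ x in (-R)..R, mixedD u 0 1 t x ^ 2 := by field_simp
    have e4 : 2 * L / ε = ε⁻¹ * L + ε⁻¹ * L := by ring
    simp only [zero_add] at s0
    linarith
  · have s1' := mul_le_mul_of_nonneg_left s1 (sq_nonneg β)
    have hk : 0 ≤ β / ε := by positivity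
    have e1 := mul_le_mul_of_nonneg_left b1 hk
    have e2 := mul_le_mul_of_nonneg_left b2 hk
    have e3 : β ^ 2 * ((β / ε)⁻¹ * ∫ x in (-R)..R, mixedD u 0 1 t x ^ 2)
        = β / ε * (ε ^ 2 * ∫ x in (-R)..R, mixedD u 0 1 t x ^ 2) := by field_simp
    have e4 : 2 * L * β / ε = β / ε * L + β / ε * L := by ring
    have e5 := mul_le_mul_of_nonneg_left h1' (sq_nonneg β)
    simp only [Nat.reduceAdd] at s1'
    linarith

end IsAdmissibleKdVRLW

namespace IsAdmissibleKdVRLW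

variable {ε β : ℝ} {u : ℝ → ℝ → ℝ}

lemma energy_bound (h : IsAdmissibleKdVRLW ε β u) {R : ℝ} {T δ K : ℝ}
    (hT : 0 ≤ T) (hflux : ∀ t ∈ Icc (0 : ℝ) T,
      |energyFlux ε β u t R| ≤ δ ∧ |energyFlux ε β u t (-R)| ≤ δ)
    (hδT : δ * T ≤ 1 / 8) (h0 : localEnergy β u R 0 ≤ K) {t : ℝ} (ht : t ∈ Icc (0 : ℝ) T) :
    localEnergy β u R t + 2 * ε * (∫ s in (0 : ℝ)..t, ∫ x in (-R)..R, mixedD u 0 1 s x ^ 2)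
      ≤ K + 1 := by
  have hc := continuous_mixedD h.smooth
  have hcI : Continuous (fun s => ∫ x in (-R)..R, mixedD u 0 1 s x ^ 2) :=
    intervalIntegral.continuous_parametric_intervalIntegral_of_continuous'
      (f := fun s x => mixedD u 0 1 s x ^ 2) (by fun_prop) _ _
  have hd : ∀ s ∈ Icc (0 : ℝ) T, HasDerivAt (fun t => localEnergy β u R t
      + 2 * ε * (∫ s in (0 : ℝ)..t, ∫ x in (-R)..R, mixedD u 0 1 s x ^ 2))
      (energyFlux ε β u s R - energyFlux ε β u s (-R)) s := by
    intro s hs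
    refine ((h.hasDerivAt_localEnergy R hs.1).add
      ((intervalIntegral.integral_hasDerivAt_right (hcI.intervalIntegrable _ _)
        (hcI.stronglyMeasurableAtFilter _ _) hcI.continuousAt).const_mul (2 * ε))).congr_deriv ?_
    ring
  have := (convex_Icc (0 : ℝ) T).image_sub_le_mul_sub_of_deriv_le (C := 2 * δ)
    (fun s hs => (hd s hs).continuousAt.continuousWithinAt)
    (fun s hs => (hd s (interior_subset hs)).differentiableAt.differentiableWithinAt)
    (fun s hs => by
      rw [(hd s (interior_subset hs)).deriv]
      have := hflux s (interior_subset hs)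
      linarith [abs_le.1 this.1, abs_le.1 this.2]) 0 ⟨le_rfl, hT⟩ t ht ht.1
  have hδ : 0 ≤ δ := (abs_nonneg _).trans (hflux 0 ⟨le_rfl, hT⟩).1
  have hδt : δ * t ≤ δ * T := mul_le_mul_of_nonneg_left ht.2 hδ
  simp only [intervalIntegral.integral_same, mul_zero, add_zero, sub_zero] at this
  linarith

lemma higher_bound (h : IsAdmissibleKdVRLW ε β u) (hε : 0 < ε) (hβ : 0 < β)
    {R : ℝ} (hR : 0 ≤ R) {T δ L : ℝ} (hT : 0 ≤ T) (hδ : 0 < δ)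
    (hflux : ∀ t ∈ Icc (0 : ℝ) T, |higherFlux ε β u t R| ≤ δ ∧ |higherFlux ε β u t (-R)| ≤ δ)
    (hu : ∀ t ∈ Icc (0 : ℝ) T, |mixedD u 0 0 t R| ≤ 1 ∧ |mixedD u 0 1 t R| ≤ 1)
    (hδT : δ * T ≤ 1 / 8) (hE : ∀ t ∈ Icc (0 : ℝ) T, localEnergy β u R t ≤ L)
    (h0 : localHigher ε β u R 0 + 1 ≤ L)
    (hs0 : β * (1 + 2 * L / ε) ≤ (ε / 100) ^ 2) (hs1 : β ^ 2 + 2 * L * β / ε ≤ (ε / 100) ^ 2)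
    (hs2 : β ≤ (ε / 100) ^ 2) :
    (∀ t ∈ Icc (0 : ℝ) T, localHigher ε β u R t ≤ L) ∧
      (∫ t in (0 : ℝ)..T, ∫ x in (-R)..R, dissipation ε β u t x) ≤ 4 * L := by
  have hrate : ∀ t ∈ Icc (0 : ℝ) T, localHigher ε β u R t ≤ L →
      ∫ x in (-R)..R, higherRate ε β u t x
        ≤ 2 * δ - 1 / 4 * ∫ x in (-R)..R, dissipation ε β u t x := by
    intro t ht hF
    have hp := fun x hx => h.pointwise_bounds hε hβ hR (hE t ht) hF (hu t ht).1 (hu t ht).2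
      (x := x) hx
    have := h.integral_higherRate_le hε hβ hR ht.1
      (fun x hx => (mul_le_mul_of_nonneg_left (hp x hx).1 hβ.le).trans hs0)
      (fun x hx => (hp x hx).2.trans hs1) hs2
    have hf := hflux t ht
    linarith [abs_le.1 hf.1, abs_le.1 hf.2]
  have hdiss : ∀ t, 0 ≤ ∫ x in (-R)..R, dissipation ε β u t x := fun t =>
    intervalIntegral.integral_nonneg (by linarith) fun x _ => by unfold dissipation; positivity
  have hF : ∀ t ∈ Icc (0 : ℝ) T, localHigher ε β u R t ≤ L := by
    have hB : ∀ t ∈ Icc (0 : ℝ) T, localHigher ε β u R 0 + 4 * δ * t ≤ L := by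
      intro t ht
      have : δ * t ≤ δ * T := mul_le_mul_of_nonneg_left ht.2 hδ.le
      linarith
    intro t ht
    refine le_trans (image_le_of_deriv_right_lt_deriv_boundary (f := localHigher ε β u R)
      (B := fun t => localHigher ε β u R 0 + 4 * δ * t) (B' := fun _ => 4 * δ)
      (fun s _ => (h.hasDerivAt_localHigher R s).continuousAt.continuousWithinAt)
      (fun s _ => (h.hasDerivAt_localHigher R s).hasDerivWithinAt) (by simp)
      (fun s => (((hasDerivAt_id s).const_mul (4 * δ)).const_add
        (localHigher ε β u R 0)).congr_deriv (by simp))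
      (fun s hs hFB => ?_) ht) (hB t ht)
    have hs' : s ∈ Icc (0 : ℝ) T := ⟨hs.1, hs.2.le⟩
    have := hrate s hs' (hFB.le.trans (hB s hs'))
    linarith [hdiss s]
  refine ⟨hF, ?_⟩
  have hcR : Continuous (fun s => ∫ x in (-R)..R, higherRate ε β u s x) :=
    intervalIntegral.continuous_parametric_intervalIntegral_of_continuous'
      (f := higherRate ε β u) h.continuous_higherRate _ _
  have hcD : Continuous (fun s => ∫ x in (-R)..R, dissipation ε β u s x) :=
    intervalIntegral.continuous_parametric_intervalIntegral_of_continuous'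
      (f := dissipation ε β u) h.continuous_dissipation _ _
  have h_int := intervalIntegral.integral_eq_sub_of_hasDerivAt (a := 0) (b := T)
    (fun t _ => h.hasDerivAt_localHigher R t) (hcR.intervalIntegrable _ _)
  have hmono : ∫ t in (0 : ℝ)..T, ∫ x in (-R)..R, higherRate ε β u t x
      ≤ ∫ t in (0 : ℝ)..T, (2 * δ - 1 / 4 * ∫ x in (-R)..R, dissipation ε β u t x) :=
    intervalIntegral.integral_mono_on hT (hcR.intervalIntegrable _ _)
    ((by fun_prop : Continuous (fun t => 2 * δ - 1 / 4 * ∫ x in (-R)..R,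
      dissipation ε β u t x)).intervalIntegrable _ _) fun t ht => hrate t ht (hF t ht)
  rw [intervalIntegral.integral_sub (by simp) ((hcD.const_mul _).intervalIntegrable _ _),
    intervalIntegral.integral_const, intervalIntegral.integral_const_mul, h_int] at hmono
  have hFT : 0 ≤ localHigher ε β u R T :=
    intervalIntegral.integral_nonneg (by linarith) fun x _ => by positivity
  simp only [sub_zero, smul_eq_mul] at hmono
  linarith

lemma integrable_sq_zero (h : IsAdmissibleKdVRLW ε β u) {k : ℕ} (hk : k ≤ 5) :
    Integrable (fun x => mixedD u 0 k 0 x ^ 2) :=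
  h.sq_int 1 one_pos 0 k (by simpa using hk) 0 ⟨le_rfl, zero_le_one⟩

lemma integrable_pow_four_zero (h : IsAdmissibleKdVRLW ε β u) :
    Integrable (fun x => mixedD u 0 0 0 x ^ 4) := by
  have hs := h.continuous_slice 0 0 0
  obtain ⟨M, hM⟩ := h.decay 1 one_pos 0 0 (by norm_num) 1 one_pos
  obtain ⟨C, hC⟩ := (isCompact_Icc (a := -M) (b := M)).exists_bound_of_continuousOn hs.continuousOn
  have hb : ∀ x, |mixedD u 0 0 0 x| ≤ max 1 C := by
    intro x
    rcases le_total M |x| with hx | hx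
    · exact (hM x hx 0 ⟨le_rfl, zero_le_one⟩).trans (le_max_left _ _)
    · exact (hC x (abs_le.1 hx)).trans (le_max_right _ _)
  refine ((h.integrable_sq_zero (k := 0) (by norm_num)).const_mul (max 1 C ^ 2)).mono'
    (by fun_prop : Continuous _).aestronglyMeasurable (.of_forall fun x => ?_)
  rw [Real.norm_of_nonneg (by positivity)]
  have := pow_le_pow_left₀ (abs_nonneg _) (hb x) 2
  rw [sq_abs] at this
  nlinarith [sq_nonneg (mixedD u 0 0 0 x)]

lemma initial_bounds (h : IsAdmissibleKdVRLW ε β u) (hε : 0 < ε) (hβ : 0 < β) {C0 : ℝ}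
    (hd : DataBoundsKdVRLW ε β C0 (u 0)) {R : ℝ} (hR : 0 ≤ R) :
    localEnergy β u R 0 ≤ 2 * C0 ∧ localHigher ε β u R 0 ≤ 2 * C0 := by
  obtain ⟨d1, d2, -⟩ := hd
  have e0 : mixedD u 0 0 0 = u 0 := by rw [mixedD_zero_zero]
  have e1 : mixedD u 0 1 0 = deriv (u 0) := by rw [mixedD_zero_eq, iteratedDeriv_one]
  rw [← mixedD_zero_eq, ← mixedD_zero_eq] at d2
  rw [← e1, ← e0] at d1
  have i0 := h.integrable_sq_zero (k := 0) (by norm_num)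
  have i1 := h.integrable_sq_zero (k := 1) (by norm_num)
  have i2 := h.integrable_sq_zero (k := 2) (by norm_num)
  have i3 := h.integrable_sq_zero (k := 3) (by norm_num)
  have i4 := h.integrable_pow_four_zero
  have hle : ∀ g : ℝ → ℝ, Integrable g → (∀ x, 0 ≤ g x) →
      ∫ x in (-R)..R, g x ≤ ∫ x, g x := by
    intro g hg hg0
    rw [intervalIntegral.integral_of_le (by linarith)]
    exact setIntegral_le_integral hg (.of_forall hg0)
  have n0 : 0 ≤ ∫ x, mixedD u 0 0 0 x ^ 2 := integral_nonneg fun x => by positivity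
  have n4 : 0 ≤ ∫ x, mixedD u 0 0 0 x ^ 4 := integral_nonneg fun x => by positivity
  constructor
  · have j1 : Integrable (fun x => mixedD u 0 0 0 x ^ 2 + β * mixedD u 0 1 0 x ^ 2) :=
      i0.add (i1.const_mul β)
    refine (hle (fun x => mixedD u 0 0 0 x ^ 2 + β * mixedD u 0 1 0 x ^ 2
      + β ^ 2 * mixedD u 0 2 0 x ^ 2) (j1.add (i2.const_mul (β ^ 2)))
      fun x => by positivity).trans ?_
    rw [integral_add j1 (i2.const_mul (β ^ 2)),
      integral_add i0 (i1.const_mul β), integral_const_mul, integral_const_mul]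
    have m1 : 0 ≤ ε ^ 2 * ∫ x, mixedD u 0 1 0 x ^ 2 := by positivity
    have m2 : 0 ≤ (β * ε + β * ε ^ 2) * ∫ x, mixedD u 0 2 0 x ^ 2 := by positivity
    have m3 : 0 ≤ (β ^ 2 * ε ^ 2 + β ^ 3) * ∫ x, mixedD u 0 3 0 x ^ 2 := by positivity
    linarith
  · have j1 : Integrable (fun x => 1 / 2 * mixedD u 0 0 0 x ^ 4 + ε ^ 2 * mixedD u 0 1 0 x ^ 2) :=
      (i4.const_mul (1 / 2)).add (i1.const_mul (ε ^ 2))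
    have j2 : Integrable (fun x => β * mixedD u 0 2 0 x ^ 2 + β ^ 2 * mixedD u 0 3 0 x ^ 2) :=
      (i2.const_mul β).add (i3.const_mul (β ^ 2))
    refine (hle (fun x => 1 / 2 * mixedD u 0 0 0 x ^ 4 + ε ^ 2 * mixedD u 0 1 0 x ^ 2
      + ε ^ 2 / 2 * (β * mixedD u 0 2 0 x ^ 2 + β ^ 2 * mixedD u 0 3 0 x ^ 2))
      (j1.add (j2.const_mul (ε ^ 2 / 2))) fun x => by positivity).trans ?_
    rw [integral_add j1 (j2.const_mul (ε ^ 2 / 2)),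
      integral_add (i4.const_mul (1 / 2)) (i1.const_mul (ε ^ 2)),
      integral_const_mul, integral_const_mul, integral_const_mul,
      integral_add (i2.const_mul β) (i3.const_mul (β ^ 2)), integral_const_mul,
      integral_const_mul]
    have m1 : 0 ≤ β * ∫ x, mixedD u 0 1 0 x ^ 2 := by positivity
    have m2 : 0 ≤ (β * ε + β ^ 2) * ∫ x, mixedD u 0 2 0 x ^ 2 := by positivity
    have m3 : 0 ≤ β ^ 3 * ∫ x, mixedD u 0 3 0 x ^ 2 := by positivity
    have m4 : 0 ≤ β * ε ^ 2 * ∫ x, mixedD u 0 2 0 x ^ 2 := by positivity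
    have m5 : 0 ≤ β ^ 2 * ε ^ 2 * ∫ x, mixedD u 0 3 0 x ^ 2 := by positivity
    linarith

lemma integral_space_time_le (h : IsAdmissibleKdVRLW ε β u) (hε : 0 < ε) (hβ : 0 < β) {T r R : ℝ}
    (hT : 0 ≤ T) (hr : 0 ≤ r) (hrR : r ≤ R) :
    ∫ t in (0 : ℝ)..T, ∫ x in (-r)..r,
        (ε * mixedD u 0 1 t x ^ 2 + ε ^ 3 * mixedD u 0 2 t x ^ 2
          + ε * β * mixedD u 1 1 t x ^ 2 + ε * β ^ 2 * mixedD u 1 2 t x ^ 2)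
      ≤ ε * (∫ t in (0 : ℝ)..T, ∫ x in (-R)..R, mixedD u 0 1 t x ^ 2)
        + ∫ t in (0 : ℝ)..T, ∫ x in (-R)..R, dissipation ε β u t x := by
  have hc := continuous_mixedD h.smooth
  have c1 : Continuous (fun p : ℝ × ℝ => mixedD u 0 1 p.1 p.2 ^ 2) := (hc 0 1).pow 2
  have c2 : Continuous (fun p : ℝ × ℝ => ε * mixedD u 0 1 p.1 p.2 ^ 2
      + ε ^ 3 * mixedD u 0 2 p.1 p.2 ^ 2
      + ε * β * mixedD u 1 1 p.1 p.2 ^ 2 + ε * β ^ 2 * mixedD u 1 2 p.1 p.2 ^ 2) := by fun_prop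
  have k1 : Continuous (fun t => ∫ x in (-R)..R, mixedD u 0 1 t x ^ 2) :=
    intervalIntegral.continuous_parametric_intervalIntegral_of_continuous'
      (f := fun s x => mixedD u 0 1 s x ^ 2) c1 _ _
  have k2 : Continuous (fun t => ∫ x in (-r)..r, (ε * mixedD u 0 1 t x ^ 2
      + ε ^ 3 * mixedD u 0 2 t x ^ 2
      + ε * β * mixedD u 1 1 t x ^ 2 + ε * β ^ 2 * mixedD u 1 2 t x ^ 2)) :=
    intervalIntegral.continuous_parametric_intervalIntegral_of_continuous'
      (f := fun t x => ε * mixedD u 0 1 t x ^ 2 + ε ^ 3 * mixedD u 0 2 t x ^ 2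
      + ε * β * mixedD u 1 1 t x ^ 2 + ε * β ^ 2 * mixedD u 1 2 t x ^ 2) c2 _ _
  have k3 : Continuous (fun t => ∫ x in (-R)..R, dissipation ε β u t x) :=
    intervalIntegral.continuous_parametric_intervalIntegral_of_continuous'
      (f := dissipation ε β u) h.continuous_dissipation _ _
  rw [← intervalIntegral.integral_const_mul, ← intervalIntegral.integral_add
    ((k1.const_mul ε).intervalIntegrable _ _) (k3.intervalIntegrable _ _)]
  refine intervalIntegral.integral_mono_on hT (k2.intervalIntegrable _ _)
    (((k1.const_mul ε).add k3).intervalIntegrable _ _) fun t _ => ?_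
  have hs := fun j k => h.continuous_slice j k t
  have s1 : Continuous (fun x => ε * mixedD u 0 1 t x ^ 2) := by fun_prop
  have s2 : Continuous (fun x => ε * mixedD u 0 1 t x ^ 2 + ε ^ 3 * mixedD u 0 2 t x ^ 2
      + ε * β * mixedD u 1 1 t x ^ 2 + ε * β ^ 2 * mixedD u 1 2 t x ^ 2) := by fun_prop
  have s3 : Continuous (fun x => dissipation ε β u t x) := by unfold dissipation; fun_prop
  rw [← intervalIntegral.integral_const_mul, ← intervalIntegral.integral_add
    (s1.intervalIntegrable _ _) (s3.intervalIntegrable _ _)]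
  refine (intervalIntegral.integral_mono_interval (c := -R) (d := R) (by linarith) (by linarith)
    hrR (.of_forall fun x => by positivity) (s2.intervalIntegrable _ _)).trans ?_
  refine intervalIntegral.integral_mono_on (by linarith) (s2.intervalIntegrable _ _)
    ((s1.add s3).intervalIntegrable _ _) fun x _ => ?_
  have n1 : 0 ≤ ε * (mixedD u 0 0 t x * mixedD u 0 1 t x) ^ 2 := by positivity
  have n2 : 0 ≤ ε * mixedD u 1 0 t x ^ 2 := by positivity
  unfold dissipation
  linarith

end IsAdmissibleKdVRLW

/-- Local a priori bounds, uniform in the approximation parameters. -/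
structure UniformBounds (C ε β : ℝ) (u : ℝ → ℝ → ℝ) (T r : ℝ) : Prop where
  slice : ∀ t ∈ Icc (0 : ℝ) T, ∫ x in (-r)..r, mixedD u 0 0 t x ^ 2 ≤ C
  grad : ∀ t ∈ Icc (0 : ℝ) T, ∀ x ∈ Icc (-r) r, β ^ 2 * mixedD u 0 1 t x ^ 2 ≤ C * ε ^ 3
  space_time : ∫ t in (0 : ℝ)..T, ∫ x in (-r)..r,
    (ε * mixedD u 0 1 t x ^ 2 + ε ^ 3 * mixedD u 0 2 t x ^ 2
      + ε * β * mixedD u 1 1 t x ^ 2 + ε * β ^ 2 * mixedD u 1 2 t x ^ 2) ≤ C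

lemma exists_uniformBounds {C0 D : ℝ} (hC0 : 0 < C0) (hD : 0 < D) :
    ∃ C > (0 : ℝ), ∃ ε₀ > (0 : ℝ), ∀ (ε β : ℝ) (u : ℝ → ℝ → ℝ), 0 < ε → ε < ε₀ → 0 < β →
      β ≤ D ^ 2 * ε ^ 4 → IsAdmissibleKdVRLW ε β u → DataBoundsKdVRLW ε β C0 (u 0) →
      ∀ T > (0 : ℝ), ∀ r > (0 : ℝ), UniformBounds C ε β u T r := by
  set L : ℝ := 2 * C0 + 1
  set A : ℝ := D ^ 4 + D ^ 2 * (1 + 2 * L) with hA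
  have hA0 : 0 < A := by positivity
  refine ⟨A + 5 * L, by positivity, min 1 (1 / (10000 * A)), by positivity, ?_⟩
  intro ε β u hε hε0 hβ hβε h hdata T hT r hr
  have hε1 : ε ≤ 1 := (hε0.trans_le (min_le_left _ _)).le
  have hεA : A * ε ≤ 1 / 10000 := by
    have := hε0.trans_le (min_le_right _ _)
    rw [lt_div_iff₀ (by positivity)] at this
    linarith
  have e3 : ε ^ 4 ≤ ε ^ 3 := pow_le_pow_of_le_one hε.le hε1 (by norm_num)
  have e8 : ε ^ 8 ≤ ε ^ 3 := pow_le_pow_of_le_one hε.le hε1 (by norm_num)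
  have hAε : A * ε ^ 3 ≤ (ε / 100) ^ 2 := by nlinarith [sq_nonneg ε]
  have hβL : 2 * L * β / ε ≤ 2 * L * (D ^ 2 * ε ^ 3) := by
    rw [div_le_iff₀ hε]
    nlinarith
  have hβ2 : β ^ 2 ≤ D ^ 4 * ε ^ 3 := by
    calc β ^ 2 ≤ (D ^ 2 * ε ^ 4) ^ 2 := by gcongr
      _ = D ^ 4 * ε ^ 8 := by ring
      _ ≤ _ := by gcongr
  have hβ1 : β ≤ D ^ 2 * ε ^ 3 := hβε.trans (by gcongr)
  have hD4 : 0 ≤ D ^ 4 * ε ^ 3 := by positivity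
  have hDL : 0 ≤ D ^ 2 * L * ε ^ 3 := by positivity
  have hs0 : β * (1 + 2 * L / ε) ≤ (ε / 100) ^ 2 := by
    have : β * (1 + 2 * L / ε) = β + 2 * L * β / ε := by ring
    linarith
  have hgrad : β ^ 2 + 2 * L * β / ε ≤ A * ε ^ 3 := by linarith
  have hs2 : β ≤ (ε / 100) ^ 2 := by linarith
  set δ : ℝ := min 1 (1 / (8 * T))
  have hδ : 0 < δ := by positivity
  have hδT : δ * T ≤ 1 / 8 := by
    calc δ * T ≤ 1 / (8 * T) * T := by gcongr; exact min_le_right _ _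
      _ = 1 / 8 := by field_simp
  obtain ⟨M₁, hM₁⟩ := h.decays_energyFlux T hT δ hδ
  obtain ⟨M₂, hM₂⟩ := h.decays_higherFlux T hT δ hδ
  obtain ⟨M₃, hM₃⟩ := h.decay T hT 0 0 (by norm_num) 1 one_pos
  obtain ⟨M₄, hM₄⟩ := h.decay T hT 0 1 (by norm_num) 1 one_pos
  obtain ⟨R, hR⟩ : ∃ R, r ≤ R ∧ M₁ ≤ R ∧ M₂ ≤ R ∧ M₃ ≤ R ∧ M₄ ≤ R :=
    ⟨max r (max M₁ (max M₂ (max M₃ M₄))), by simp⟩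
  obtain ⟨hrR, r1, r2, r3, r4⟩ := hR
  have hR0 : 0 < R := hr.trans_le hrR
  have aR : |R| = R := abs_of_pos hR0
  have aR' : |-R| = R := by rw [abs_neg, aR]
  obtain ⟨i1, i2⟩ := h.initial_bounds hε hβ hdata hR0.le
  have hE := fun t ht => h.energy_bound hT.le (t := t)
    (fun t ht => ⟨hM₁ R (by rwa [aR]) t ht, hM₁ (-R) (by rwa [aR']) t ht⟩) hδT i1 ht
  have hEt : ∀ t ∈ Icc (0 : ℝ) T, localEnergy β u R t ≤ L := by
    intro t ht
    have : 0 ≤ ∫ s in (0 : ℝ)..t, ∫ x in (-R)..R, mixedD u 0 1 s x ^ 2 :=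
      intervalIntegral.integral_nonneg ht.1 fun s _ =>
        intervalIntegral.integral_nonneg (by linarith) fun x _ => by positivity
    have h2 : 0 ≤ 2 * ε * ∫ s in (0 : ℝ)..t, ∫ x in (-R)..R, mixedD u 0 1 s x ^ 2 := by positivity
    linarith [hE t ht]
  obtain ⟨hF, hdiss⟩ := h.higher_bound hε hβ hR0.le hT.le hδ
    (fun t ht => ⟨hM₂ R (by rwa [aR]) t ht, hM₂ (-R) (by rwa [aR']) t ht⟩)
    (fun t ht => ⟨hM₃ R (by rwa [aR]) t ht, hM₄ R (by rwa [aR]) t ht⟩)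
    hδT hEt (by linarith) hs0 (hgrad.trans hAε) hs2
  have hsl := h.continuous_slice
  refine ⟨fun t ht => ?_, fun t ht x hx => ?_, ?_⟩
  · have := (h.slice_bounds hε hβ hR0.le (hEt t ht) (hF t ht)).1
    refine (intervalIntegral.integral_mono_interval (by linarith) (by linarith) hrR
      (.of_forall fun x => by positivity)
      ((by fun_prop : Continuous _).intervalIntegrable _ _)).trans (this.trans ?_)
    linarith
  · have := (h.pointwise_bounds hε hβ hR0.le (hEt t ht) (hF t ht)
      (hM₃ R (by rwa [aR]) t ht) (hM₄ R (by rwa [aR]) t ht)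
      (x := x) ⟨by linarith [hx.1], by linarith [hx.2]⟩).2
    have h5 : 0 ≤ 5 * L * ε ^ 3 := by positivity
    linarith
  · have hfin := h.integral_space_time_le hε hβ hT.le hr.le hrR
    have hET := hE T ⟨hT.le, le_rfl⟩
    have hnn : 0 ≤ localEnergy β u R T :=
      intervalIntegral.integral_nonneg (by linarith) fun x _ => by positivity
    linarith

lemma abs_le_one_add_sq_and_products (P R B C : ℝ) :
    |P| ≤ 1 + (P ^ 2 + R ^ 2 + B ^ 2 + C ^ 2) ∧ |R| ≤ 1 + (P ^ 2 + R ^ 2 + B ^ 2 + C ^ 2) ∧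
    |B| ≤ 1 + (P ^ 2 + R ^ 2 + B ^ 2 + C ^ 2) ∧ |C| ≤ 1 + (P ^ 2 + R ^ 2 + B ^ 2 + C ^ 2) ∧
    |P| * |R| ≤ 1 + (P ^ 2 + R ^ 2 + B ^ 2 + C ^ 2) ∧
    |P| * |B| ≤ 1 + (P ^ 2 + R ^ 2 + B ^ 2 + C ^ 2) ∧
    |P| * |C| ≤ 1 + (P ^ 2 + R ^ 2 + B ^ 2 + C ^ 2) ∧
    |R| * |C| ≤ 1 + (P ^ 2 + R ^ 2 + B ^ 2 + C ^ 2) := by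
  rw [← sq_abs P, ← sq_abs R, ← sq_abs B, ← sq_abs C]
  have nP := sq_nonneg |P|
  have nR := sq_nonneg |R|
  have nB := sq_nonneg |B|
  have nC := sq_nonneg |C|
  refine ⟨?_, ?_, ?_, ?_, ?_, ?_, ?_, ?_⟩
  · linarith [two_mul_le_add_sq |P| 1]
  · linarith [two_mul_le_add_sq |R| 1]
  · linarith [two_mul_le_add_sq |B| 1]
  · linarith [two_mul_le_add_sq |C| 1]
  · linarith [two_mul_le_add_sq |P| |R|]
  · linarith [two_mul_le_add_sq |P| |B|]
  · linarith [two_mul_le_add_sq |P| |C|]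
  · linarith [two_mul_le_add_sq |R| |C|]

lemma entropy_error_le {θ σ D G p r b c K k₁ k₂ k₃ k₄ k₅ k₆ k₇ k₈ k₉ : ℝ} (hθ : 0 < θ)
    (hθ1 : θ ≤ 1) (hσ : 0 ≤ σ) (hD : 0 ≤ D) (hσθ : σ ≤ D * θ ^ 4) (hp : |σ ^ 2 * p| ≤ G * θ ^ 3)
    (h₁ : |k₁| ≤ K) (h₂ : |k₂| ≤ K) (h₃ : |k₃| ≤ K) (h₄ : |k₄| ≤ K) (h₅ : |k₅| ≤ K) (h₆ : |k₆| ≤ K)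
    (h₇ : |k₇| ≤ K) (h₈ : |k₈| ≤ K) (h₉ : |k₉| ≤ K) :
    -(10 * K * (1 + D + D ^ 2 + G) * θ * (1 + ((θ * p) ^ 2 + (θ ^ 3 * r) ^ 2 + (θ * σ * b) ^ 2
      + (θ * σ ^ 2 * c) ^ 2)))
      ≤ k₁ * (θ ^ 2 * p) - k₂ * (σ ^ 2 * r) - k₃ * (σ ^ 2 * p * r) + k₄ * (σ ^ 2 * b)
        + k₅ * (σ ^ 2 * p * b) + k₆ * (σ ^ 4 * c) + 2 * (k₇ * (σ ^ 4 * p * c))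
        + k₈ * (σ ^ 4 * p ^ 2 * c) + k₉ * (σ ^ 4 * r * c) := by
  have hG : 0 ≤ G := by
    have := (abs_nonneg _).trans hp
    exact nonneg_of_mul_nonneg_left this (by positivity)
  have hD2 : 0 ≤ D ^ 2 := by positivity
  set E : ℝ := 1 + D + D ^ 2 + G with hE
  have hσ2 : σ ^ 2 ≤ D ^ 2 * θ ^ 8 := by
    calc σ ^ 2 ≤ (D * θ ^ 4) ^ 2 := by gcongr
      _ = _ := by ring
  set S : ℝ := 1 + ((θ * p) ^ 2 + (θ ^ 3 * r) ^ 2 + (θ * σ * b) ^ 2 + (θ * σ ^ 2 * c) ^ 2) with hS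
  have key : ∀ X e y k : ℝ, ∀ m : ℕ, |k| ≤ K → |X| ≤ e * θ ^ m * y → 0 ≤ e → e ≤ E → m ≠ 0 →
      0 ≤ y → y ≤ S → |k * X| ≤ K * (E * θ * S) := by
    intro X e y k m hk hX he heE hm hy hyS
    rw [abs_mul]
    refine mul_le_mul hk (hX.trans ?_) (abs_nonneg _) ((abs_nonneg _).trans hk)
    have : θ ^ m ≤ θ := pow_le_of_le_one hθ.le hθ1 hm
    gcongr
  obtain ⟨y1, y2, y3, y4, y12, y13, y14, y24⟩ :=
    abs_le_one_add_sq_and_products (θ * p) (θ ^ 3 * r) (θ * σ * b) (θ * σ ^ 2 * c)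
  have z1 := key (θ ^ 2 * p) 1 |θ * p| k₁ 1 h₁ (by
    rw [show θ ^ 2 * p = θ * (θ * p) by ring, abs_mul, abs_of_pos hθ]; simp) (by norm_num)
    (by linarith) (by norm_num) (abs_nonneg _) y1
  have z2 := key (σ ^ 2 * r) (D ^ 2) |θ ^ 3 * r| k₂ 5 h₂ (by
    rw [abs_mul, abs_mul, abs_of_nonneg (sq_nonneg σ), abs_of_pos (pow_pos hθ 3)]
    calc σ ^ 2 * |r| ≤ D ^ 2 * θ ^ 8 * |r| := by gcongr
      _ = _ := by ring) hD2 (by linarith) (by norm_num) (abs_nonneg _) y2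
  have z3 := key (σ ^ 2 * p * r) (D ^ 2) (|θ * p| * |θ ^ 3 * r|) k₃ 4 h₃ (by
    rw [abs_mul, abs_mul, abs_mul, abs_mul, abs_of_nonneg (sq_nonneg σ), abs_of_pos (pow_pos hθ 3),
      abs_of_pos hθ]
    calc σ ^ 2 * |p| * |r| ≤ D ^ 2 * θ ^ 8 * |p| * |r| := by gcongr
      _ = _ := by ring) hD2 (by linarith) (by norm_num) (by positivity) y12
  have z4 := key (σ ^ 2 * b) D |θ * σ * b| k₄ 3 h₄ (by
    rw [abs_mul, abs_mul, abs_mul, abs_of_nonneg (sq_nonneg σ), abs_of_nonneg hσ, abs_of_pos hθ]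
    calc σ ^ 2 * |b| = σ * (σ * |b|) := by ring
      _ ≤ D * θ ^ 4 * (σ * |b|) := by gcongr
      _ = _ := by ring) hD (by linarith) (by norm_num) (by positivity) y3
  have z5 := key (σ ^ 2 * p * b) D (|θ * p| * |θ * σ * b|) k₅ 2 h₅ (by
    rw [abs_mul, abs_mul, abs_mul, abs_mul, abs_mul, abs_of_nonneg (sq_nonneg σ), abs_of_nonneg hσ,
      abs_of_pos hθ]
    calc σ ^ 2 * |p| * |b| = σ * (σ * |p| * |b|) := by ring
      _ ≤ D * θ ^ 4 * (σ * |p| * |b|) := by gcongr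
      _ = _ := by ring) hD (by linarith) (by norm_num) (by positivity) y13
  have z6 := key (σ ^ 4 * c) (D ^ 2) |θ * σ ^ 2 * c| k₆ 7 h₆ (by
    rw [abs_mul, abs_mul, abs_mul, abs_of_nonneg (by positivity : 0 ≤ σ ^ 4),
      abs_of_nonneg (sq_nonneg σ), abs_of_pos hθ]
    calc σ ^ 4 * |c| = σ ^ 2 * (σ ^ 2 * |c|) := by ring
      _ ≤ D ^ 2 * θ ^ 8 * (σ ^ 2 * |c|) := by gcongr
      _ = _ := by ring) hD2 (by linarith) (by norm_num) (by positivity) y4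
  have z7 := key (σ ^ 4 * p * c) (D ^ 2) (|θ * p| * |θ * σ ^ 2 * c|) k₇ 6 h₇ (by
    rw [abs_mul, abs_mul, abs_mul, abs_mul, abs_mul, abs_of_nonneg (by positivity : 0 ≤ σ ^ 4),
      abs_of_nonneg (sq_nonneg σ), abs_of_pos hθ]
    calc σ ^ 4 * |p| * |c| = σ ^ 2 * (σ ^ 2 * |p| * |c|) := by ring
      _ ≤ D ^ 2 * θ ^ 8 * (σ ^ 2 * |p| * |c|) := by gcongr
      _ = _ := by ring) hD2 (by linarith) (by norm_num) (by positivity) y14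
  have z8 := key (σ ^ 4 * p ^ 2 * c) G (|θ * p| * |θ * σ ^ 2 * c|) k₈ 1 h₈ (by
    have e1 : |σ ^ 4 * p ^ 2 * c| = |σ ^ 2 * p| * (|p| * |σ ^ 2 * c|) := by
      rw [← abs_mul p, ← abs_mul]; ring_nf
    have e2 : |θ * p| * |θ * σ ^ 2 * c| = θ ^ 2 * (|p| * |σ ^ 2 * c|) := by
      rw [mul_assoc θ, abs_mul θ p, abs_mul θ, abs_of_pos hθ]; ring
    rw [e1, e2]
    calc |σ ^ 2 * p| * (|p| * |σ ^ 2 * c|) ≤ G * θ ^ 3 * (|p| * |σ ^ 2 * c|) := by gcongr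
      _ = _ := by ring) hG (by linarith) (by norm_num) (by positivity) y14
  have z9 := key (σ ^ 4 * r * c) (D ^ 2) (|θ ^ 3 * r| * |θ * σ ^ 2 * c|) k₉ 4 h₉ (by
    rw [abs_mul, abs_mul, abs_mul, abs_mul, abs_mul, abs_of_nonneg (by positivity : 0 ≤ σ ^ 4),
      abs_of_nonneg (sq_nonneg σ), abs_of_pos hθ, abs_of_pos (pow_pos hθ 3)]
    calc σ ^ 4 * |r| * |c| = σ ^ 2 * (σ ^ 2 * |r| * |c|) := by ring
      _ ≤ D ^ 2 * θ ^ 8 * (σ ^ 2 * |r| * |c|) := by gcongr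
      _ = _ := by ring) hD2 (by linarith) (by norm_num) (by positivity) y24
  rw [abs_le] at z1 z2 z3 z4 z5 z6 z7 z8 z9
  linarith [z1.1, z2.2, z3.2, z4.1, z5.1, z6.1, z7.1, z8.1, z9.1]

/-- A `C³` convex entropy `h₀` with derivatives `h₁`, `h₂`, `h₃` bounded by `M` and flux `q`. -/
structure SmoothEntropy (M : ℝ) (h₀ h₁ h₂ h₃ q : ℝ → ℝ) : Prop where
  deriv₀ : ∀ v, HasDerivAt h₀ (h₁ v) v
  deriv₁ : ∀ v, HasDerivAt h₁ (h₂ v) v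
  deriv₂ : ∀ v, HasDerivAt h₂ (h₃ v) v
  cont₃ : Continuous h₃
  flux : ∀ v, HasDerivAt q (2 * v * h₁ v) v
  nonneg₂ : ∀ v, 0 ≤ h₂ v
  bound₁ : ∀ v, |h₁ v| ≤ M
  bound₂ : ∀ v, |h₂ v| ≤ M
  bound₃ : ∀ v, |h₃ v| ≤ M

/-- A nonnegative test function supported in `(0,T) × (-r,r)`. -/
structure IsTestFunction (Φ T r : ℝ) (φ : ℝ → ℝ → ℝ) : Prop where
  smooth : ContDiff ℝ ∞ (fun p : ℝ × ℝ => φ p.1 p.2)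
  nonneg : ∀ t x, 0 ≤ mixedD φ 0 0 t x
  bound : ∀ j k, j + k ≤ 2 → ∀ t x, |mixedD φ j k t x| ≤ Φ
  eq_zero : ∀ j k t x, t ∉ Ioo 0 T ∨ x ∉ Ioo (-r) r → mixedD φ j k t x = 0

/-- Space flux in the local entropy balance. -/
def entropyFlux (ε β : ℝ) (h₁ h₂ q : ℝ → ℝ) (u φ : ℝ → ℝ → ℝ) (t x : ℝ) : ℝ :=
  q (mixedD u 0 0 t x) * mixedD φ 0 0 t x
    - ε * (mixedD φ 0 0 t x * h₁ (mixedD u 0 0 t x) * mixedD u 0 1 t x)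
    + β * (mixedD φ 0 0 t x * h₁ (mixedD u 0 0 t x) * mixedD u 0 2 t x)
    - β * (mixedD φ 0 0 t x * h₁ (mixedD u 0 0 t x) * mixedD u 1 1 t x)
    + β ^ 2 * (mixedD φ 0 0 t x * h₁ (mixedD u 0 0 t x) * mixedD u 1 3 t x)
    - β ^ 2 * ((mixedD φ 0 1 t x * h₁ (mixedD u 0 0 t x)
      + mixedD φ 0 0 t x * h₂ (mixedD u 0 0 t x) * mixedD u 0 1 t x) * mixedD u 1 2 t x)

/-- Space derivative of `entropyFlux`. -/
def entropyFluxDeriv (ε β : ℝ) (h₁ h₂ h₃ q : ℝ → ℝ) (u φ : ℝ → ℝ → ℝ) (t x : ℝ) : ℝ :=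
  2 * mixedD u 0 0 t x * h₁ (mixedD u 0 0 t x) * mixedD u 0 1 t x * mixedD φ 0 0 t x
    + q (mixedD u 0 0 t x) * mixedD φ 0 1 t x
    - ε * ((mixedD φ 0 1 t x * h₁ (mixedD u 0 0 t x)
      + mixedD φ 0 0 t x * (h₂ (mixedD u 0 0 t x) * mixedD u 0 1 t x)) * mixedD u 0 1 t x
      + mixedD φ 0 0 t x * h₁ (mixedD u 0 0 t x) * mixedD u 0 2 t x)
    + β * ((mixedD φ 0 1 t x * h₁ (mixedD u 0 0 t x)
      + mixedD φ 0 0 t x * (h₂ (mixedD u 0 0 t x) * mixedD u 0 1 t x)) * mixedD u 0 2 t x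
      + mixedD φ 0 0 t x * h₁ (mixedD u 0 0 t x) * mixedD u 0 3 t x)
    - β * ((mixedD φ 0 1 t x * h₁ (mixedD u 0 0 t x)
      + mixedD φ 0 0 t x * (h₂ (mixedD u 0 0 t x) * mixedD u 0 1 t x)) * mixedD u 1 1 t x
      + mixedD φ 0 0 t x * h₁ (mixedD u 0 0 t x) * mixedD u 1 2 t x)
    + β ^ 2 * ((mixedD φ 0 1 t x * h₁ (mixedD u 0 0 t x)
      + mixedD φ 0 0 t x * (h₂ (mixedD u 0 0 t x) * mixedD u 0 1 t x)) * mixedD u 1 3 t x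
      + mixedD φ 0 0 t x * h₁ (mixedD u 0 0 t x) * mixedD u 1 4 t x)
    - β ^ 2 * ((mixedD φ 0 2 t x * h₁ (mixedD u 0 0 t x)
        + mixedD φ 0 1 t x * (h₂ (mixedD u 0 0 t x) * mixedD u 0 1 t x)
        + ((mixedD φ 0 1 t x * h₂ (mixedD u 0 0 t x)
          + mixedD φ 0 0 t x * (h₃ (mixedD u 0 0 t x) * mixedD u 0 1 t x)) * mixedD u 0 1 t x
          + mixedD φ 0 0 t x * h₂ (mixedD u 0 0 t x) * mixedD u 0 2 t x)) * mixedD u 1 2 t x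
      + (mixedD φ 0 1 t x * h₁ (mixedD u 0 0 t x)
        + mixedD φ 0 0 t x * h₂ (mixedD u 0 0 t x) * mixedD u 0 1 t x) * mixedD u 1 3 t x)

section EntropyProduction

variable {ε β M : ℝ} {h₀ h₁ h₂ h₃ q : ℝ → ℝ} {u φ : ℝ → ℝ → ℝ}

lemma SmoothEntropy.hasDerivAt_entropyFlux (hS : SmoothEntropy M h₀ h₁ h₂ h₃ q)
    (hu : ContDiff ℝ ∞ (fun p : ℝ × ℝ => u p.1 p.2))
    (hφ : ContDiff ℝ ∞ (fun p : ℝ × ℝ => φ p.1 p.2)) (t x : ℝ) :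
    HasDerivAt (entropyFlux ε β h₁ h₂ q u φ t) (entropyFluxDeriv ε β h₁ h₂ h₃ q u φ t x) x := by
  have d := fun j k => hasDerivAt_mixedD_right hu j k t x
  have f := fun j k => hasDerivAt_mixedD_right hφ j k t x
  have e₁ := (hS.deriv₁ (mixedD u 0 0 t x)).comp x (d 0 0)
  have e₂ := (hS.deriv₂ (mixedD u 0 0 t x)).comp x (d 0 0)
  have eq := (hS.flux (mixedD u 0 0 t x)).comp x (d 0 0)
  have m := (f 0 0).mul e₁
  have m' := ((f 0 1).mul e₁).add (((f 0 0).mul e₂).mul (d 0 1))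
  have key := (((((eq.mul (f 0 0)).sub ((m.mul (d 0 1)).const_mul ε)).add
    ((m.mul (d 0 2)).const_mul β)).sub ((m.mul (d 1 1)).const_mul β)).add
    ((m.mul (d 1 3)).const_mul (β ^ 2))).sub ((m'.mul (d 1 2)).const_mul (β ^ 2))
  refine HasDerivAt.congr_deriv (f := entropyFlux ε β h₁ h₂ q u φ t) key ?_
  simp only [entropyFluxDeriv, Function.comp_apply, Pi.mul_apply, Pi.add_apply, zero_add]

lemma SmoothEntropy.continuous (hS : SmoothEntropy M h₀ h₁ h₂ h₃ q) :
    Continuous h₀ ∧ Continuous h₁ ∧ Continuous h₂ ∧ Continuous q :=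
  ⟨continuous_iff_continuousAt.2 fun v => (hS.deriv₀ v).continuousAt,
    continuous_iff_continuousAt.2 fun v => (hS.deriv₁ v).continuousAt,
    continuous_iff_continuousAt.2 fun v => (hS.deriv₂ v).continuousAt,
    continuous_iff_continuousAt.2 fun v => (hS.flux v).continuousAt⟩

/-- Pointwise entropy balance with the dissipation dropped and the dispersive terms estimated. -/
lemma IsAdmissibleKdVRLW.entropy_balance_le (h : IsAdmissibleKdVRLW ε β u)
    (hS : SmoothEntropy M h₀ h₁ h₂ h₃ q) {Φ T r : ℝ} (hφ : IsTestFunction Φ T r φ)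
    (hε : 0 < ε) (hε1 : ε ≤ 1) (hβ : 0 < β) {D G : ℝ} (hD : 0 ≤ D) (hβε : β ≤ D ^ 2 * ε ^ 4)
    (hG : 0 ≤ G) {t x : ℝ} (ht : 0 ≤ t) (hp : β ^ 2 * mixedD u 0 1 t x ^ 2 ≤ G ^ 2 * ε ^ 3) :
    h₁ (mixedD u 0 0 t x) * mixedD u 1 0 t x * mixedD φ 0 0 t x
        + h₀ (mixedD u 0 0 t x) * mixedD φ 1 0 t x
        + entropyFluxDeriv ε β h₁ h₂ h₃ q u φ t x
      ≤ h₀ (mixedD u 0 0 t x) * mixedD φ 1 0 t x + q (mixedD u 0 0 t x) * mixedD φ 0 1 t x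
        + 10 * (Φ * M) * (1 + D + D ^ 2 + G) * √ε * (1 + (ε * mixedD u 0 1 t x ^ 2
          + ε ^ 3 * mixedD u 0 2 t x ^ 2 + ε * β * mixedD u 1 1 t x ^ 2
          + ε * β ^ 2 * mixedD u 1 2 t x ^ 2)) := by
  have hθ2 : √ε ^ 2 = ε := Real.sq_sqrt hε.le
  have hσ2 : √β ^ 2 = β := Real.sq_sqrt hβ.le
  have hθ0 : 0 < √ε := Real.sqrt_pos.2 hε
  have hΦM : ∀ k, k ≤ 2 → ∀ w, |w| ≤ M → |mixedD φ 0 k t x * w| ≤ Φ * M := by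
    intro k hk w hw
    rw [abs_mul]
    have := hφ.bound 0 k (by simpa using hk) t x
    exact mul_le_mul this hw (abs_nonneg _) ((abs_nonneg _).trans this)
  set v := mixedD u 0 0 t x with hv
  have key := entropy_error_le (θ := √ε) (σ := √β) (D := D) (G := G) (p := mixedD u 0 1 t x)
    (r := mixedD u 0 2 t x) (b := mixedD u 1 1 t x) (c := mixedD u 1 2 t x) hθ0
    (Real.sqrt_le_one.2 hε1) (Real.sqrt_nonneg β) hD
    (by
      rw [Real.sqrt_le_left (by positivity)]
      calc β ≤ D ^ 2 * ε ^ 4 := hβε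
        _ = (D * √ε ^ 4) ^ 2 := by rw [← hθ2]; simp only [Real.sqrt_sq hθ0.le]; ring)
    (by
      rw [hσ2]
      refine abs_le_of_sq_le_sq ?_ (by positivity)
      calc (β * mixedD u 0 1 t x) ^ 2 = β ^ 2 * mixedD u 0 1 t x ^ 2 := by ring
        _ ≤ _ := hp
        _ = (G * √ε ^ 3) ^ 2 := by rw [← hθ2]; simp only [Real.sqrt_sq hθ0.le]; ring)
    (hΦM 1 (by norm_num) _ (hS.bound₁ v)) (hΦM 1 (by norm_num) _ (hS.bound₁ v))
    (hΦM 0 (by norm_num) _ (hS.bound₂ v)) (hΦM 1 (by norm_num) _ (hS.bound₁ v))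
    (hΦM 0 (by norm_num) _ (hS.bound₂ v)) (hΦM 2 (by norm_num) _ (hS.bound₁ v))
    (hΦM 1 (by norm_num) _ (hS.bound₂ v)) (hΦM 0 (by norm_num) _ (hS.bound₃ v))
    (hΦM 0 (by norm_num) _ (hS.bound₂ v))
  have hσ4 : √β ^ 4 = β ^ 2 := by rw [← hσ2]; simp only [Real.sqrt_sq (Real.sqrt_nonneg _)]; ring
  have hθ6 : (√ε ^ 3) ^ 2 = ε ^ 3 := by
    rw [← hθ2]; simp only [Real.sqrt_sq (Real.sqrt_nonneg _)]; ring
  simp only [mul_pow, hθ6, hσ4, hθ2, hσ2] at key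
  have hdis : 0 ≤ ε * (mixedD φ 0 0 t x * h₂ v * mixedD u 0 1 t x ^ 2) := by
    have := hφ.nonneg t x
    have := hS.nonneg₂ v
    positivity
  have hpde := congrArg (fun z => h₁ v * mixedD φ 0 0 t x * z) (h.pde_nonneg ht x)
  simp only [← hv] at hpde
  simp only [entropyFluxDeriv, ← hv]
  linarith

end EntropyProduction

lemma intervalIntegrable_inner {f : ℝ → ℝ → ℝ} (hf : Continuous (fun p : ℝ × ℝ => f p.1 p.2))
    (a b c d : ℝ) : IntervalIntegrable (fun t => ∫ x in a..b, f t x) volume c d :=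
  (intervalIntegral.continuous_parametric_intervalIntegral_of_continuous' (f := f) hf
    a b).intervalIntegrable _ _

lemma Continuous.slice_intervalIntegrable {f : ℝ → ℝ → ℝ}
    (hf : Continuous (fun p : ℝ × ℝ => f p.1 p.2)) (t a b : ℝ) :
    IntervalIntegrable (fun x => f t x) volume a b :=
  (hf.comp (by fun_prop : Continuous (fun x : ℝ => (t, x)))).intervalIntegrable _ _

section EntropyProduction

variable {ε β M : ℝ} {h₀ h₁ h₂ h₃ q : ℝ → ℝ} {u φ : ℝ → ℝ → ℝ}

lemma SmoothEntropy.continuous_entropyFluxDeriv (hS : SmoothEntropy M h₀ h₁ h₂ h₃ q)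
    (hu : ContDiff ℝ ∞ (fun p : ℝ × ℝ => u p.1 p.2))
    (hφ : ContDiff ℝ ∞ (fun p : ℝ × ℝ => φ p.1 p.2)) :
    Continuous (fun p : ℝ × ℝ => entropyFluxDeriv ε β h₁ h₂ h₃ q u φ p.1 p.2) := by
  obtain ⟨-, c₁, c₂, cq⟩ := hS.continuous
  have c₃ := hS.cont₃
  have hc := continuous_mixedD hu
  have hf := continuous_mixedD hφ
  unfold entropyFluxDeriv
  generalize mixedD u = a at hc ⊢
  generalize mixedD φ = b at hf ⊢
  fun_prop

lemma SmoothEntropy.integral_time_density_eq_zero (hS : SmoothEntropy M h₀ h₁ h₂ h₃ q)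
    (hu : ContDiff ℝ ∞ (fun p : ℝ × ℝ => u p.1 p.2)) {Φ T r : ℝ} (hφ : IsTestFunction Φ T r φ) :
    ∫ t in (0 : ℝ)..T, ∫ x in (-r)..r,
      (h₁ (mixedD u 0 0 t x) * mixedD u 1 0 t x * mixedD φ 0 0 t x
        + h₀ (mixedD u 0 0 t x) * mixedD φ 1 0 t x) = 0 := by
  obtain ⟨c₀, c₁, -, -⟩ := hS.continuous
  have hc := continuous_mixedD hu
  have hf := continuous_mixedD hφ.smooth
  have cont : Continuous (fun p : ℝ × ℝ =>
      h₁ (mixedD u 0 0 p.1 p.2) * mixedD u 1 0 p.1 p.2 * mixedD φ 0 0 p.1 p.2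
        + h₀ (mixedD u 0 0 p.1 p.2) * mixedD φ 1 0 p.1 p.2) := by
    generalize mixedD u = a at hc ⊢
    generalize mixedD φ = b at hf ⊢
    fun_prop
  have hd := fun t => hasDerivAt_intervalIntegral_of_continuous
    (f := fun t x => h₀ (mixedD u 0 0 t x) * mixedD φ 0 0 t x)
    (f' := fun t x => h₁ (mixedD u 0 0 t x) * mixedD u 1 0 t x * mixedD φ 0 0 t x
        + h₀ (mixedD u 0 0 t x) * mixedD φ 1 0 t x) 
    (by
      generalize mixedD u = a at hc ⊢
      generalize mixedD φ = b at hf ⊢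
      fun_prop) cont
    (fun t x => ((hS.deriv₀ _).comp t (hasDerivAt_mixedD_left hu 0 0 t x)).mul
      (hasDerivAt_mixedD_left hφ.smooth 0 0 t x)) (-r) r t
  rw [intervalIntegral.integral_eq_sub_of_hasDerivAt (fun t _ => hd t)
    (intervalIntegrable_inner (f := fun t x =>
      h₁ (mixedD u 0 0 t x) * mixedD u 1 0 t x * mixedD φ 0 0 t x
        + h₀ (mixedD u 0 0 t x) * mixedD φ 1 0 t x) cont _ _ _ _)]
  simp [hφ.eq_zero 0 0 T _ (.inl (by simp)), hφ.eq_zero 0 0 0 _ (.inl (by simp))]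

/-- Approximate entropy inequality for admissible solutions. -/
lemma IsAdmissibleKdVRLW.entropy_production (h : IsAdmissibleKdVRLW ε β u)
    (hS : SmoothEntropy M h₀ h₁ h₂ h₃ q) {Φ T r : ℝ} (hφ : IsTestFunction Φ T r φ)
    (hε : 0 < ε) (hε1 : ε ≤ 1) (hβ : 0 < β) {D C : ℝ} (hD : 0 ≤ D) (hβε : β ≤ D ^ 2 * ε ^ 4)
    (hC : 0 ≤ C) (hT : 0 ≤ T) (hr : 0 ≤ r) (hb : UniformBounds C ε β u T r) :
    -(10 * (Φ * M) * (1 + D + D ^ 2 + √C) * √ε * (2 * r * T + C))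
      ≤ ∫ t in (0 : ℝ)..T, ∫ x in (-r)..r, (h₀ (mixedD u 0 0 t x) * mixedD φ 1 0 t x
        + q (mixedD u 0 0 t x) * mixedD φ 0 1 t x) := by
  obtain ⟨c₀, c₁, -, cq⟩ := hS.continuous
  have hc := continuous_mixedD h.smooth
  have hf := continuous_mixedD hφ.smooth
  have hM : 0 ≤ M := (abs_nonneg _).trans (hS.bound₁ 0)
  have hΦ : 0 ≤ Φ := (abs_nonneg _).trans (hφ.bound 0 0 (by norm_num) 0 0)
  have hrr : -r ≤ r := by linarith
  set K : ℝ := 10 * (Φ * M) * (1 + D + D ^ 2 + √C) * √ε with hK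
  have hK0 : 0 ≤ K := by positivity
  set g : ℝ → ℝ → ℝ := fun t x => h₀ (mixedD u 0 0 t x) * mixedD φ 1 0 t x
    + q (mixedD u 0 0 t x) * mixedD φ 0 1 t x with hg
  set τ : ℝ → ℝ → ℝ := fun t x => h₁ (mixedD u 0 0 t x) * mixedD u 1 0 t x * mixedD φ 0 0 t x
    + h₀ (mixedD u 0 0 t x) * mixedD φ 1 0 t x with hτ
  set S : ℝ → ℝ → ℝ := fun t x => ε * mixedD u 0 1 t x ^ 2
    + ε ^ 3 * mixedD u 0 2 t x ^ 2 + ε * β * mixedD u 1 1 t x ^ 2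
    + ε * β ^ 2 * mixedD u 1 2 t x ^ 2 with hSdef
  have cg : Continuous (fun p : ℝ × ℝ => g p.1 p.2) := by
    simp only [hg]
    generalize mixedD u = a at hc ⊢
    generalize mixedD φ = b at hf ⊢
    fun_prop
  have cτ : Continuous (fun p : ℝ × ℝ => τ p.1 p.2) := by
    simp only [hτ]
    generalize mixedD u = a at hc ⊢
    generalize mixedD φ = b at hf ⊢
    fun_prop
  have cS : Continuous (fun p : ℝ × ℝ => S p.1 p.2) := by
    simp only [hSdef]
    generalize mixedD u = a at hc ⊢
    generalize mixedD φ = b at hf ⊢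
    fun_prop
  have cF := hS.continuous_entropyFluxDeriv (ε := ε) (β := β) h.smooth hφ.smooth
  have hslice : ∀ t ∈ Icc (0 : ℝ) T, ∫ x in (-r)..r, τ t x
      ≤ (∫ x in (-r)..r, g t x) + K * (2 * r + ∫ x in (-r)..r, S t x) := by
    intro t ht
    have hzero : ∫ x in (-r)..r, entropyFluxDeriv ε β h₁ h₂ h₃ q u φ t x = 0 := by
      rw [intervalIntegral.integral_eq_sub_of_hasDerivAt
        (fun x _ => hS.hasDerivAt_entropyFlux h.smooth hφ.smooth t x)
        (cF.slice_intervalIntegrable t _ _)]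
      simp [entropyFlux, hφ.eq_zero 0 0 t r (.inr (by simp)), hφ.eq_zero 0 1 t r (.inr (by simp)),
        hφ.eq_zero 0 0 t (-r) (.inr (by simp)), hφ.eq_zero 0 1 t (-r) (.inr (by simp))]
    have hone : ∫ x in (-r)..r, (1 + S t x) = 2 * r + ∫ x in (-r)..r, S t x := by
      rw [intervalIntegral.integral_add (by simp) (cS.slice_intervalIntegrable t _ _)]
      simp; ring
    calc ∫ x in (-r)..r, τ t x
        = ∫ x in (-r)..r, (τ t x + entropyFluxDeriv ε β h₁ h₂ h₃ q u φ t x) := by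
          rw [intervalIntegral.integral_add (cτ.slice_intervalIntegrable t _ _)
            (cF.slice_intervalIntegrable t _ _), hzero, add_zero]
      _ ≤ ∫ x in (-r)..r, (g t x + K * (1 + S t x)) := by
          refine intervalIntegral.integral_mono_on hrr
            ((cτ.add cF).slice_intervalIntegrable
              (f := fun t x => τ t x + entropyFluxDeriv ε β h₁ h₂ h₃ q u φ t x) t _ _)
            ((by fun_prop : Continuous (fun p : ℝ × ℝ => g p.1 p.2
              + K * (1 + S p.1 p.2))).slice_intervalIntegrable
              (f := fun t x => g t x + K * (1 + S t x)) t _ _) fun x hx => ?_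
          exact h.entropy_balance_le hS hφ hε hε1 hβ hD hβε (Real.sqrt_nonneg C) ht.1
            (by rw [Real.sq_sqrt hC]; exact hb.grad t ht x hx)
      _ = _ := by
          rw [intervalIntegral.integral_add (cg.slice_intervalIntegrable t _ _)
            ((by fun_prop : Continuous (fun p : ℝ × ℝ =>
              K * (1 + S p.1 p.2))).slice_intervalIntegrable
              (f := fun t x => K * (1 + S t x)) t _ _), intervalIntegral.integral_const_mul, hone]
  have jg := intervalIntegrable_inner cg (-r) r 0 T
  have jS := intervalIntegrable_inner cS (-r) r 0 T
  have j2 : IntervalIntegrable (fun t => K * (2 * r + ∫ x in (-r)..r, S t x)) volume 0 T :=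
    (intervalIntegrable_const.add jS).const_mul K
  have h_int := intervalIntegral.integral_mono_on hT (intervalIntegrable_inner cτ (-r) r 0 T)
    (jg.add j2) hslice
  rw [hS.integral_time_density_eq_zero h.smooth hφ, intervalIntegral.integral_add jg j2,
    intervalIntegral.integral_const_mul, intervalIntegral.integral_add intervalIntegrable_const jS,
    intervalIntegral.integral_const] at h_int
  have hst : K * ((∫ t in (0 : ℝ)..T, ∫ x in (-r)..r, S t x)) ≤ K * C :=
    mul_le_mul_of_nonneg_left hb.space_time hK0
  simp only [sub_zero, smul_eq_mul] at h_int
  linarith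

end EntropyProduction

section Smoothing

variable {η : ℝ → ℝ} {M₁ M₂ : ℝ}

lemma abs_sub_le_of_abs_deriv_le {f f' : ℝ → ℝ} (hf : ∀ x, HasDerivAt f (f' x) x) {M : ℝ}
    (hM : ∀ x, |f' x| ≤ M) (x y : ℝ) : |f y - f x| ≤ M * |y - x| :=
  convex_univ.norm_image_sub_le_of_norm_hasDerivWithin_le
    (fun z _ => (hf z).hasDerivWithinAt) (fun z _ => hM z) (mem_univ x) (mem_univ y)

/-- Forward averages of a convex `C²` function give convex `C³` entropies converging to it. -/
lemma exists_smoothEntropy (hη : ContDiff ℝ 2 η) (hconv : ConvexOn ℝ univ η)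
    (h₁ : ∀ v, |deriv η v| ≤ M₁) (h₂ : ∀ v, |iteratedDeriv 2 η v| ≤ M₂) {q : ℝ → ℝ}
    (hq : ∀ v, q v = ∫ ξ in (0 : ℝ)..v, 2 * ξ * deriv η ξ) {s : ℝ} (hs : 0 < s) :
    ∃ M, ∃ e₀ e₁ e₂ e₃ p : ℝ → ℝ, SmoothEntropy M e₀ e₁ e₂ e₃ p ∧
      (∀ v, |e₀ v - η v| ≤ M₁ * s) ∧ ∀ v, |p v - q v| ≤ 2 * M₂ * s * v ^ 2 := by
  have d₀ : ∀ v, HasDerivAt η (deriv η v) v := fun v =>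
    (hη.differentiable (by norm_num) v).hasDerivAt
  have hη' : ContDiff ℝ 1 (deriv η) := by
    have : ContDiff ℝ (1 + 1) η := hη
    exact (contDiff_succ_iff_deriv.1 this).2.2
  have d₁ : ∀ v, HasDerivAt (deriv η) (iteratedDeriv 2 η v) v := fun v => by
    have := (hη'.differentiable (by norm_num) v).hasDerivAt
    rwa [show iteratedDeriv 2 η = deriv (deriv η) by
      rw [iteratedDeriv_succ, iteratedDeriv_one]]
  have c₀ : Continuous η := hη.continuous
  have c₁ : Continuous (deriv η) := hη'.continuous
  have hmono : Monotone (deriv η) := by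
    have := hconv.monotoneOn_deriv fun x _ => (d₀ x).differentiableAt
    simpa [monotoneOn_univ] using this
  have hM₁ : 0 ≤ M₁ := (abs_nonneg _).trans (h₁ 0)
  have hM₂ : 0 ≤ M₂ := (abs_nonneg _).trans (h₂ 0)
  have l₀ := abs_sub_le_of_abs_deriv_le d₀ h₁
  have l₁ := abs_sub_le_of_abs_deriv_le d₁ h₂
  have shift : ∀ {f f' : ℝ → ℝ}, (∀ v, HasDerivAt f (f' v) v) → ∀ v,
      HasDerivAt (fun v => s⁻¹ * (f (v + s) - f v)) (s⁻¹ * (f' (v + s) - f' v)) v := by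
    intro f f' hf v
    exact (((hf (v + s)).comp_add_const v s).sub (hf v)).const_mul s⁻¹
  have inv_le : ∀ {a b : ℝ}, |a| ≤ b * s → |s⁻¹ * a| ≤ b := by
    intro a b hab
    rw [abs_mul, abs_of_pos (inv_pos.2 hs), inv_mul_le_iff₀ hs]
    linarith
  have diff_quot : ∀ v, |s⁻¹ * (η (v + s) - η v) - deriv η v| ≤ M₂ * s := by
    intro v
    obtain ⟨c, hc, hce⟩ := exists_hasDerivAt_eq_slope η (deriv η) (by linarith : v < v + s)
      c₀.continuousOn fun x _ => d₀ x
    have : s⁻¹ * (η (v + s) - η v) = deriv η c := by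
      rw [hce, add_sub_cancel_left, div_eq_inv_mul]
    rw [this]
    refine (l₁ v c).trans (mul_le_mul_of_nonneg_left ?_ hM₂)
    rw [abs_of_pos (by linarith [hc.1])]
    linarith [hc.2]
  refine ⟨M₁ + M₂ + 2 * M₂ / s, fun v => s⁻¹ * ∫ ξ in v..v + s, η ξ,
    fun v => s⁻¹ * (η (v + s) - η v), fun v => s⁻¹ * (deriv η (v + s) - deriv η v),
    fun v => s⁻¹ * (iteratedDeriv 2 η (v + s) - iteratedDeriv 2 η v),
    fun v => ∫ ξ in (0 : ℝ)..v, 2 * ξ * (s⁻¹ * (η (ξ + s) - η ξ)),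
    ⟨fun v => ?_, shift d₀, shift d₁, by fun_prop, fun v => ?_, fun v => ?_, fun v => ?_,
      fun v => ?_, fun v => ?_⟩, fun v => ?_, fun v => ?_⟩
  · have h0 : ∀ w, HasDerivAt (fun w => ∫ ξ in (0 : ℝ)..w, η ξ) (η w) w := fun w =>
      intervalIntegral.integral_hasDerivAt_right (c₀.intervalIntegrable _ _)
        (c₀.stronglyMeasurableAtFilter _ _) c₀.continuousAt
    refine (shift h0 v).congr_of_eventuallyEq (.of_forall fun w => ?_)
    simp only
    rw [intervalIntegral.integral_interval_sub_left (c₀.intervalIntegrable _ _)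
      (c₀.intervalIntegrable _ _)]
  · have hcq : Continuous (fun ξ => 2 * ξ * (s⁻¹ * (η (ξ + s) - η ξ))) := by fun_prop
    exact intervalIntegral.integral_hasDerivAt_right (hcq.intervalIntegrable _ _)
      (hcq.stronglyMeasurableAtFilter _ _) hcq.continuousAt
  · exact mul_nonneg (inv_pos.2 hs).le (sub_nonneg.2 (hmono (by linarith)))
  · have : 0 ≤ 2 * M₂ / s := by positivity
    have := inv_le (a := η (v + s) - η v) (b := M₁) (by
      simpa [abs_of_pos hs] using l₀ v (v + s))
    linarith
  · have : 0 ≤ 2 * M₂ / s := by positivity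
    have := inv_le (a := deriv η (v + s) - deriv η v) (b := M₂) (by
      simpa [abs_of_pos hs] using l₁ v (v + s))
    linarith
  · have := inv_le (a := iteratedDeriv 2 η (v + s) - iteratedDeriv 2 η v) (b := 2 * M₂ / s) (by
      rw [div_mul_cancel₀ _ hs.ne']
      linarith [abs_sub (iteratedDeriv 2 η (v + s)) (iteratedDeriv 2 η v), h₂ (v + s), h₂ v])
    linarith
  · have : (s⁻¹ * ∫ ξ in v..v + s, η ξ) - η v = s⁻¹ * ∫ ξ in v..v + s, (η ξ - η v) := by
      rw [intervalIntegral.integral_sub (c₀.intervalIntegrable _ _) intervalIntegrable_const]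
      simp [mul_sub, inv_mul_cancel_left₀ hs.ne']
    rw [this]
    refine inv_le ?_
    have := intervalIntegral.norm_integral_le_of_norm_le_const (a := v) (b := v + s)
      (f := fun ξ => η ξ - η v) (C := M₁ * s) fun x hx => by
        rw [uIoc_of_le (by linarith)] at hx
        refine (l₀ v x).trans (mul_le_mul_of_nonneg_left ?_ hM₁)
        rw [abs_of_pos (by linarith [hx.1])]
        linarith [hx.2]
    simpa [abs_of_pos hs] using this
  · have hcq : Continuous (fun ξ => 2 * ξ * (s⁻¹ * (η (ξ + s) - η ξ))) := by fun_prop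
    have hcq' : Continuous (fun ξ => 2 * ξ * deriv η ξ) := by fun_prop
    simp only
    rw [hq, ← intervalIntegral.integral_sub (hcq.intervalIntegrable _ _)
      (hcq'.intervalIntegrable _ _)]
    have := intervalIntegral.norm_integral_le_of_norm_le_const (a := 0) (b := v)
      (f := fun ξ => 2 * ξ * (s⁻¹ * (η (ξ + s) - η ξ)) - 2 * ξ * deriv η ξ)
      (C := 2 * |v| * (M₂ * s)) fun x hx => by
        rw [Real.norm_eq_abs, ← mul_sub, abs_mul, abs_mul, abs_two]
        have hx' : |x| ≤ |v| := by
          have := abs_sub_left_of_mem_uIcc (uIoc_subset_uIcc hx)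
          simpa using this
        have := diff_quot x
        gcongr
    rw [Real.norm_eq_abs, sub_zero] at this
    refine this.trans_eq ?_
    rw [← sq_abs v]
    ring

end Smoothing

lemma eventually_entropy_production_ge {C₀ D : ℝ} (hC₀ : 0 < C₀) (hD : 0 < D) {ε β : ℕ → ℝ}
    (hε : ∀ n, 0 < ε n) (hβ : ∀ n, 0 < β n) (hε0 : Tendsto ε atTop (nhds 0))
    (hscale : ∀ n, β n ≤ D ^ 2 * ε n ^ 4) {u : ℕ → ℝ → ℝ → ℝ}
    (hadm : ∀ n, IsAdmissibleKdVRLW (ε n) (β n) (u n))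
    (hdb : ∀ n, DataBoundsKdVRLW (ε n) (β n) C₀ (u n 0))
    {η : ℝ → ℝ} (hη : ContDiff ℝ 2 η) (hconv : ConvexOn ℝ univ η) {M₁ M₂ : ℝ}
    (h₁ : ∀ v, |deriv η v| ≤ M₁) (h₂ : ∀ v, |iteratedDeriv 2 η v| ≤ M₂) {q : ℝ → ℝ}
    (hq : ∀ v, q v = ∫ ξ in (0 : ℝ)..v, 2 * ξ * deriv η ξ)
    {Φ T r : ℝ} {φ : ℝ → ℝ → ℝ} (hφ : IsTestFunction Φ T r φ) (hT : 0 < T) (hr : 0 < r)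
    {δ : ℝ} (hδ : 0 < δ) :
    ∀ᶠ n in atTop, -δ ≤ ∫ t in (0 : ℝ)..T, ∫ x in (-r)..r,
      (η (mixedD (u n) 0 0 t x) * mixedD φ 1 0 t x
        + q (mixedD (u n) 0 0 t x) * mixedD φ 0 1 t x) := by
  obtain ⟨C, hC, ε₀, hε₀, hub⟩ := exists_uniformBounds hC₀ hD
  have hM₁ : 0 ≤ M₁ := (abs_nonneg _).trans (h₁ 0)
  have hM₂ : 0 ≤ M₂ := (abs_nonneg _).trans (h₂ 0)
  have hΦ : 0 ≤ Φ := (abs_nonneg _).trans (hφ.bound 0 0 (by norm_num) 0 0)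
  set A : ℝ := Φ * (M₁ * (2 * r) + 2 * M₂ * C) * T with hA
  set s : ℝ := δ / (2 * (A + 1)) with hs
  have hs0 : 0 < s := by positivity
  have hsA : A * s ≤ δ / 2 := by
    rw [hs, mul_div_assoc', div_le_div_iff₀ (by positivity) two_pos]
    nlinarith
  obtain ⟨M, e₀, e₁, e₂, e₃, p, hS, he, hp⟩ := exists_smoothEntropy hη hconv h₁ h₂ hq hs0
  have hlim : Tendsto (fun n => 10 * (Φ * M) * (1 + D + D ^ 2 + √C) * √(ε n)
      * (2 * r * T + C)) atTop (nhds 0) := by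
    have := ((hε0.sqrt.const_mul (10 * (Φ * M) * (1 + D + D ^ 2 + √C))).mul_const
      (2 * r * T + C))
    simpa using this
  have c₀ := hη.continuous
  obtain ⟨ce, -, -, cp⟩ := hS.continuous
  have c₁ : Continuous (deriv η) := hη.continuous_deriv (by norm_num)
  have cq : Continuous q := by
    rw [show q = fun v => ∫ ξ in (0 : ℝ)..v, 2 * ξ * deriv η ξ from funext hq]
    exact intervalIntegral.continuous_primitive
      (fun a b => (by fun_prop : Continuous fun ξ => 2 * ξ * deriv η ξ).intervalIntegrable _ _) 0
  filter_upwards [hlim.eventually (gt_mem_nhds (half_pos hδ)),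
    hε0.eventually (gt_mem_nhds hε₀), hε0.eventually (gt_mem_nhds one_pos)] with n hn1 hn2 hn3
  have h := hadm n
  have hb := hub _ _ _ (hε n) hn2 (hβ n) (hscale n) h (hdb n) T hT r hr
  have hprod := h.entropy_production hS hφ (hε n) hn3.le (hβ n) hD.le (hscale n) hC.le hT.le
    hr.le hb
  have hc := continuous_mixedD h.smooth
  have hf := continuous_mixedD hφ.smooth
  have hp1 := hφ.bound 1 0 (by norm_num)
  have hp2 := hφ.bound 0 1 (by norm_num)
  have hsl := hb.slice
  generalize mixedD (u n) = a at *
  generalize mixedD φ = b at *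
  have cg : Continuous (fun z : ℝ × ℝ => η (a 0 0 z.1 z.2) * b 1 0 z.1 z.2
      + q (a 0 0 z.1 z.2) * b 0 1 z.1 z.2) := by fun_prop
  have cg' : Continuous (fun z : ℝ × ℝ => e₀ (a 0 0 z.1 z.2) * b 1 0 z.1 z.2
      + p (a 0 0 z.1 z.2) * b 0 1 z.1 z.2) := by fun_prop
  have cs : Continuous (fun z : ℝ × ℝ => s * Φ * (M₁ + 2 * M₂ * a 0 0 z.1 z.2 ^ 2)) := by fun_prop
  have hcomp : ∀ t ∈ Icc (0 : ℝ) T,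
      ∫ x in (-r)..r, (e₀ (a 0 0 t x) * b 1 0 t x + p (a 0 0 t x) * b 0 1 t x)
      ≤ (∫ x in (-r)..r, (η (a 0 0 t x) * b 1 0 t x + q (a 0 0 t x) * b 0 1 t x))
        + s * Φ * (M₁ * (2 * r) + 2 * M₂ * C) := by
    intro t ht
    have i1 := cg.slice_intervalIntegrable
      (f := fun t x => η (a 0 0 t x) * b 1 0 t x + q (a 0 0 t x) * b 0 1 t x) t (-r) r
    have i2 := cg'.slice_intervalIntegrable
      (f := fun t x => e₀ (a 0 0 t x) * b 1 0 t x + p (a 0 0 t x) * b 0 1 t x) t (-r) r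
    have i3 := cs.slice_intervalIntegrable
      (f := fun t x => s * Φ * (M₁ + 2 * M₂ * a 0 0 t x ^ 2)) t (-r) r
    have i4 := ((hc 0 0).pow 2).slice_intervalIntegrable (f := fun t x => a 0 0 t x ^ 2) t (-r) r
    have hm := intervalIntegral.integral_mono_on (by linarith : -r ≤ r) i2 (i1.add i3)
      fun x _ => by
        have k1 : (e₀ (a 0 0 t x) - η (a 0 0 t x)) * b 1 0 t x ≤ M₁ * s * Φ := by
          refine (le_abs_self _).trans ?_
          rw [abs_mul]
          exact mul_le_mul (he _) (hp1 t x) (abs_nonneg _) (by positivity)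
        have k2 : (p (a 0 0 t x) - q (a 0 0 t x)) * b 0 1 t x
            ≤ 2 * M₂ * s * a 0 0 t x ^ 2 * Φ := by
          refine (le_abs_self _).trans ?_
          rw [abs_mul]
          exact mul_le_mul (hp _) (hp2 t x) (abs_nonneg _) (by positivity)
        show _ ≤ (η (a 0 0 t x) * b 1 0 t x + q (a 0 0 t x) * b 0 1 t x)
          + s * Φ * (M₁ + 2 * M₂ * a 0 0 t x ^ 2)
        linarith
    rw [intervalIntegral.integral_add i1 i3, intervalIntegral.integral_const_mul,
      intervalIntegral.integral_add intervalIntegrable_const (i4.const_mul _),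
      intervalIntegral.integral_const_mul, intervalIntegral.integral_const] at hm
    have : s * Φ * (2 * M₂ * ∫ x in (-r)..r, a 0 0 t x ^ 2) ≤ s * Φ * (2 * M₂ * C) := by
      have := hsl t ht
      gcongr
    simp only [smul_eq_mul] at hm
    linarith
  have j1 := intervalIntegrable_inner
    (f := fun t x => η (a 0 0 t x) * b 1 0 t x + q (a 0 0 t x) * b 0 1 t x) cg (-r) r 0 T
  have j2 := intervalIntegrable_inner
    (f := fun t x => e₀ (a 0 0 t x) * b 1 0 t x + p (a 0 0 t x) * b 0 1 t x) cg' (-r) r 0 T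
  have hm := intervalIntegral.integral_mono_on hT.le j2 (j1.add intervalIntegrable_const) hcomp
  rw [intervalIntegral.integral_add j1 intervalIntegrable_const,
    intervalIntegral.integral_const] at hm
  simp only [sub_zero, smul_eq_mul] at hm
  have : T * (s * Φ * (M₁ * (2 * r) + 2 * M₂ * C)) = A * s := by rw [hA]; ring
  linarith

lemma mixedD_eq_zero_of_notMem_tsupport {φ : ℝ → ℝ → ℝ} (j k : ℕ) {z : ℝ × ℝ}
    (hz : z ∉ tsupport (fun p : ℝ × ℝ => φ p.1 p.2)) : mixedD φ j k z.1 z.2 = 0 := by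
  have hopen : IsOpen (tsupport (fun p : ℝ × ℝ => φ p.1 p.2))ᶜ :=
    (isClosed_tsupport _).isOpen_compl
  have hk : ∀ k, ∀ z ∉ tsupport (fun p : ℝ × ℝ => φ p.1 p.2), mixedD φ 0 k z.1 z.2 = 0 := by
    intro k
    induction k with
    | zero => exact fun z hz => by simpa [mixedD_zero_zero] using image_eq_zero_of_notMem_tsupport hz
    | succ k ih =>
      rintro ⟨t, x⟩ hz
      have hev : (fun y => mixedD φ 0 k t y) =ᶠ[nhds x] fun _ => 0 := by
        have : Continuous fun y : ℝ => (t, y) := by fun_prop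
        filter_upwards [this.continuousAt.eventually (hopen.mem_nhds hz)] with y hy
        exact ih (t, y) hy
      rw [mixedD_zero_succ, hev.deriv_eq, deriv_const]
  induction j generalizing z with
  | zero => exact hk k z hz
  | succ j ih =>
    obtain ⟨t, x⟩ := z
    have hev : (fun s => mixedD φ j k s x) =ᶠ[nhds t] fun _ => 0 := by
      have : Continuous fun s : ℝ => (s, x) := by fun_prop
      filter_upwards [this.continuousAt.eventually (hopen.mem_nhds hz)] with s hs
      exact ih hs
    rw [mixedD_succ_left, hev.deriv_eq, deriv_const]

lemma exists_isTestFunction {φ : ℝ → ℝ → ℝ} (hφ : ContDiff ℝ ∞ (fun p : ℝ × ℝ => φ p.1 p.2))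
    (hc : HasCompactSupport (fun p : ℝ × ℝ => φ p.1 p.2))
    (hs : tsupport (fun p : ℝ × ℝ => φ p.1 p.2) ⊆ Ioi (0 : ℝ) ×ˢ univ)
    (h0 : ∀ t x, 0 ≤ φ t x) :
    ∃ a T r Φ : ℝ, 0 < a ∧ a < T ∧ 0 < r ∧ IsTestFunction Φ T r φ ∧
      ∀ j k t x, t ≤ a → mixedD φ j k t x = 0 := by
  set K := tsupport (fun p : ℝ × ℝ => φ p.1 p.2) with hK
  have hcK : IsCompact K := hc
  have hpos : ∀ z ∈ K, 0 < z.1 := fun z hz => (hs hz).1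
  obtain ⟨c, hcb⟩ := hcK.exists_bound_of_continuousOn
    (f := fun z : ℝ × ℝ => (z.1)⁻¹) (continuousOn_fst.inv₀ fun z hz => (hpos z hz).ne')
  obtain ⟨R, hR⟩ := hcK.exists_bound_of_continuousOn (f := fun z : ℝ × ℝ => z) continuousOn_id
  have ha : ∀ z ∈ K, 1 / (|c| + 1) < z.1 := by
    intro z hz
    have h1 : (z.1)⁻¹ < |c| + 1 := by
      have := (le_abs_self _).trans (hcb z hz)
      linarith [le_abs_self c]
    rw [one_div]
    exact inv_lt_of_inv_lt₀ (hpos z hz) h1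
  have hb : ∀ z ∈ K, |z.1| < |R| + 2 ∧ |z.2| < |R| + 2 := by
    intro z hz
    have h1 := hR z hz
    have h2 : |z.1| ≤ ‖z‖ := norm_fst_le z
    have h3 : |z.2| ≤ ‖z‖ := norm_snd_le z
    have h4 := le_abs_self R
    constructor <;> linarith
  have hbound : ∀ j k, ∃ Φ, ∀ t x, |mixedD φ j k t x| ≤ Φ := by
    intro j k
    obtain ⟨Φ, hΦ⟩ := hcK.exists_bound_of_continuousOn
      (f := fun z : ℝ × ℝ => mixedD φ j k z.1 z.2) (continuous_mixedD hφ j k).continuousOn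
    refine ⟨|Φ|, fun t x => ?_⟩
    by_cases hz : (t, x) ∈ K
    · exact (hΦ _ hz).trans (le_abs_self _)
    · rw [show mixedD φ j k t x = 0 from mixedD_eq_zero_of_notMem_tsupport j k hz, abs_zero]
      exact abs_nonneg _
  choose B hB using hbound
  have hB0 : ∀ j k, 0 ≤ B j k := fun j k => (abs_nonneg _).trans (hB j k 0 0)
  refine ⟨1 / (|c| + 1), |R| + 2, |R| + 2, ∑ j ∈ Finset.range 3, ∑ k ∈ Finset.range 3, B j k,
    by positivity, ?_, by positivity, ⟨hφ, ?_, ?_, ?_⟩, ?_⟩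
  · have : 1 / (|c| + 1) ≤ 1 := by
      rw [div_le_one (by positivity)]
      linarith [abs_nonneg c]
    linarith [abs_nonneg R]
  · simpa [mixedD_zero_zero] using h0
  · intro j k hjk t x
    refine (hB j k t x).trans ?_
    refine le_trans (Finset.single_le_sum (f := fun k => B j k) (fun i _ => hB0 j i)
      (Finset.mem_range.2 (by omega : k < 3))) ?_
    exact Finset.single_le_sum (f := fun j => ∑ k ∈ Finset.range 3, B j k)
      (fun i _ => Finset.sum_nonneg fun k _ => hB0 i k) (Finset.mem_range.2 (by omega : j < 3))
  · intro j k t x h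
    refine mixedD_eq_zero_of_notMem_tsupport (z := (t, x)) j k fun hz => ?_
    obtain ⟨h1, h2⟩ := hb _ hz
    have h3 : 0 < t := hpos _ hz
    rcases h with h | h
    · exact h ⟨h3, (abs_lt.1 h1).2⟩
    · exact h ⟨(abs_lt.1 h2).1, (abs_lt.1 h2).2⟩
  · intro j k t x h
    exact mixedD_eq_zero_of_notMem_tsupport (z := (t, x)) j k fun hz => (ha _ hz).not_ge h

lemma integrable_sq_of_tendsto_ae {α : Type*} [MeasurableSpace α] {μ : Measure α}
    {f : ℕ → α → ℝ} {g : α → ℝ} {C : ℝ} (hf : ∀ n, AEStronglyMeasurable (f n) μ)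
    (hfg : ∀ᵐ z ∂μ, Tendsto (fun n => f n z) atTop (nhds (g z)))
    (h_int : ∀ n, Integrable (fun z => f n z ^ 2) μ)
    (hC : ∀ᶠ n in atTop, ∫ z, f n z ^ 2 ∂μ ≤ C) : Integrable (fun z => g z ^ 2) μ := by
  refine ⟨(aestronglyMeasurable_of_tendsto_ae atTop hf hfg).pow 2, ?_⟩
  have hsq : ∀ᵐ z ∂μ, Tendsto (fun n => f n z ^ 2) atTop (nhds (g z ^ 2)) := by
    filter_upwards [hfg] with z hz using hz.pow 2
  have h1 : ∫⁻ z, ‖g z ^ 2‖ₑ ∂μ ≤ liminf (fun n => ∫⁻ z, ‖f n z ^ 2‖ₑ ∂μ) atTop := by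
    rw [lintegral_congr_ae (g := fun z => liminf (fun n => ‖f n z ^ 2‖ₑ) atTop)
      (by filter_upwards [hsq] with z hz using hz.enorm.liminf_eq.symm)]
    exact lintegral_liminf_le' fun n => ((hf n).pow 2).enorm
  have h2 : liminf (fun n => ∫⁻ z, ‖f n z ^ 2‖ₑ ∂μ) atTop ≤ ENNReal.ofReal C := by
    refine (liminf_le_liminf (v := fun _ => ENNReal.ofReal C) ?_).trans (by simp)
    filter_upwards [hC] with n hn
    rw [← ofReal_integral_norm_eq_lintegral_enorm (h_int n)]
    refine ENNReal.ofReal_le_ofReal (le_trans (le_of_eq ?_) hn)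
    simp
  exact (h1.trans h2).trans_lt ENNReal.ofReal_lt_top

section Entropy

variable {η q : ℝ → ℝ} {M : ℝ}

lemma abs_flux_sub_le (hη : Continuous (deriv η)) (hM : ∀ v, |deriv η v| ≤ M)
    (hq : ∀ v, q v = ∫ ξ in (0 : ℝ)..v, 2 * ξ * deriv η ξ) (v w : ℝ) :
    |q v - q w| ≤ 2 * M * ((|w| + |v - w|) * |v - w|) := by
  have hc : Continuous fun ξ => 2 * ξ * deriv η ξ := by fun_prop
  have hsub : q v - q w = ∫ ξ in w..v, 2 * ξ * deriv η ξ := by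
    rw [hq, hq, intervalIntegral.integral_interval_sub_left (hc.intervalIntegrable _ _)
      (hc.intervalIntegrable _ _)]
  rw [hsub, ← Real.norm_eq_abs]
  refine (intervalIntegral.norm_integral_le_of_norm_le_const
    (C := 2 * (|w| + |v - w|) * M) fun ξ hξ => ?_).trans (le_of_eq (by ring))
  have h1 : |ξ - w| ≤ |v - w| := abs_sub_left_of_mem_uIcc (uIoc_subset_uIcc hξ)
  have h2 : |ξ| ≤ |w| + |v - w| := by
    have := abs_add_le w (ξ - w)
    rw [add_sub_cancel] at this
    linarith
  rw [Real.norm_eq_abs, abs_mul, abs_mul, abs_two]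
  exact mul_le_mul (by linarith) (hM ξ) (abs_nonneg _) (by positivity)

lemma abs_entropy_pair_sub_le (hη : Differentiable ℝ η) (hη' : Continuous (deriv η))
    (hM : ∀ v, |deriv η v| ≤ M) (hq : ∀ v, q v = ∫ ξ in (0 : ℝ)..v, 2 * ξ * deriv η ξ)
    {Φ a b : ℝ} (ha : |a| ≤ Φ) (hb : |b| ≤ Φ) {s : ℝ} (hs : 0 < s) (v w : ℝ) :
    |(η v * a + q v * b) - (η w * a + q w * b)|
      ≤ Φ * M * (s * (1 + w ^ 2) + (2 + 2 / s) * (v - w) ^ 2) := by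
  have hM0 : 0 ≤ M := (abs_nonneg _).trans (hM 0)
  have hΦ : 0 ≤ Φ := (abs_nonneg _).trans ha
  have h1 : |η v - η w| ≤ M * |v - w| := abs_sub_le_of_abs_deriv_le (fun x => (hη x).hasDerivAt) hM w v
  have h2 := abs_flux_sub_le hη' hM hq v w
  have h3 : |(η v * a + q v * b) - (η w * a + q w * b)|
      ≤ |η v - η w| * Φ + |q v - q w| * Φ := by
    rw [show (η v * a + q v * b) - (η w * a + q w * b) = (η v - η w) * a + (q v - q w) * b by ring]
    refine (abs_add_le _ _).trans ?_
    rw [abs_mul, abs_mul]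
    gcongr
  have h4 : |v - w| + 2 * ((|w| + |v - w|) * |v - w|)
      ≤ s * (1 + w ^ 2) + (2 + 2 / s) * (v - w) ^ 2 := by
    rw [← sq_abs w, ← sq_abs (v - w)]
    have h5 : |v - w| ≤ s + 1 / s * |v - w| ^ 2 := by
      have : s + 1 / s * |v - w| ^ 2 - |v - w|
        = (1 / s) * ((s - |v - w| / 2) ^ 2 + 3 / 4 * |v - w| ^ 2) := by field_simp; ring
      have h0 : 0 ≤ (1 / s) * ((s - |v - w| / 2) ^ 2 + 3 / 4 * |v - w| ^ 2) := by positivity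
      linarith
    have h6 : 2 * (|w| * |v - w|) ≤ s * |w| ^ 2 + 1 / s * |v - w| ^ 2 := by
      have : s * |w| ^ 2 + 1 / s * |v - w| ^ 2 - 2 * (|w| * |v - w|)
        = (1 / s) * (s * |w| - |v - w|) ^ 2 := by field_simp; ring
      have h0 : 0 ≤ (1 / s) * (s * |w| - |v - w|) ^ 2 := by positivity
      linarith
    have : (2 + 2 / s) * |v - w| ^ 2
      = 2 * |v - w| ^ 2 + 1 / s * |v - w| ^ 2 + 1 / s * |v - w| ^ 2 := by ring
    rw [this]
    linarith
  calc _ ≤ |η v - η w| * Φ + |q v - q w| * Φ := h3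
    _ ≤ (M * |v - w|) * Φ + (2 * M * ((|w| + |v - w|) * |v - w|)) * Φ := by gcongr
    _ = Φ * M * (|v - w| + 2 * ((|w| + |v - w|) * |v - w|)) := by ring
    _ ≤ _ := by gcongr

lemma integrable_entropy_pair {α : Type*} [MeasurableSpace α] {μ : Measure α} [IsFiniteMeasure μ]
    (hη : Differentiable ℝ η) (hη' : Continuous (deriv η)) (hM : ∀ v, |deriv η v| ≤ M)
    (hq : ∀ v, q v = ∫ ξ in (0 : ℝ)..v, 2 * ξ * deriv η ξ) {Φ : ℝ} {a b v : α → ℝ}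
    (ha : AEStronglyMeasurable a μ) (hb : AEStronglyMeasurable b μ)
    (ha' : ∀ z, |a z| ≤ Φ) (hb' : ∀ z, |b z| ≤ Φ)
    (hv : AEStronglyMeasurable v μ) (hv2 : Integrable (fun z => v z ^ 2) μ) :
    Integrable (fun z => η (v z) * a z + q (v z) * b z) μ := by
  have hqc : Continuous q := by
    have hc : Continuous fun ξ => 2 * ξ * deriv η ξ := by fun_prop
    rw [funext hq]
    exact intervalIntegral.continuous_primitive (fun _ _ => hc.intervalIntegrable _ _) 0
  have hq0 : q 0 = 0 := by simp [hq]
  have hdom : Integrable (fun z => Φ * M * (1 + (2 + 2) * v z ^ 2) + |η 0| * Φ) μ :=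
    (((integrable_const 1).add (hv2.const_mul (2 + 2))).const_mul (Φ * M)).add (integrable_const _)
  refine hdom.mono' (((hη.continuous.comp_aestronglyMeasurable hv).mul ha).add
    ((hqc.comp_aestronglyMeasurable hv).mul hb)) (Eventually.of_forall fun z => ?_)
  have h := abs_entropy_pair_sub_le hη hη' hM hq (ha' z) (hb' z) one_pos (v z) 0
  have h2 : |η 0 * a z| ≤ |η 0| * Φ := by
    rw [abs_mul]
    exact mul_le_mul_of_nonneg_left (ha' z) (abs_nonneg _)
  rw [hq0, zero_mul, add_zero] at h
  norm_num at h
  rw [Real.norm_eq_abs]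
  have h3 := abs_sub_abs_le_abs_sub (η (v z) * a z + q (v z) * b z) (η 0 * a z)
  norm_num
  linarith

lemma tendsto_integral_entropy_pair {α : Type*} [MeasurableSpace α] {μ : Measure α}
    [IsFiniteMeasure μ] (hη : Differentiable ℝ η) (hη' : Continuous (deriv η))
    (hM : ∀ v, |deriv η v| ≤ M) (hq : ∀ v, q v = ∫ ξ in (0 : ℝ)..v, 2 * ξ * deriv η ξ)
    {Φ : ℝ} (hΦ : 0 ≤ Φ) {a b w : α → ℝ} {v : ℕ → α → ℝ} (ha : AEStronglyMeasurable a μ)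
    (hb : AEStronglyMeasurable b μ) (ha' : ∀ z, |a z| ≤ Φ) (hb' : ∀ z, |b z| ≤ Φ)
    (hv : ∀ n, AEStronglyMeasurable (v n) μ) (hv2 : ∀ n, Integrable (fun z => v n z ^ 2) μ)
    (hw : AEStronglyMeasurable w μ) (hw2 : Integrable (fun z => w z ^ 2) μ)
    (hvw : Tendsto (fun n => ∫ z, (v n z - w z) ^ 2 ∂μ) atTop (nhds 0)) :
    Tendsto (fun n => ∫ z, (η (v n z) * a z + q (v n z) * b z) ∂μ) atTop
      (nhds (∫ z, (η (w z) * a z + q (w z) * b z) ∂μ)) := by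
  have hM0 : 0 ≤ M := (abs_nonneg _).trans (hM 0)
  have hsub : ∀ n, Integrable (fun z => (v n z - w z) ^ 2) μ := by
    intro n
    refine (((hv2 n).const_mul 2).add (hw2.const_mul 2)).mono' (((hv n).sub hw).pow 2)
      (Eventually.of_forall fun z => ?_)
    rw [Real.norm_eq_abs, abs_of_nonneg (by positivity)]
    change _ ≤ 2 * v n z ^ 2 + 2 * w z ^ 2
    nlinarith [sq_nonneg (v n z + w z)]
  have hone : Integrable (fun z => 1 + w z ^ 2) μ := (integrable_const 1).add hw2
  set A : ℝ := ∫ z, (1 + w z ^ 2) ∂μ with hA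
  have hest : ∀ n, ∀ s > 0, |(∫ z, (η (v n z) * a z + q (v n z) * b z) ∂μ)
      - ∫ z, (η (w z) * a z + q (w z) * b z) ∂μ|
      ≤ Φ * M * (s * A + (2 + 2 / s) * ∫ z, (v n z - w z) ^ 2 ∂μ) := by
    intro n s hs
    rw [← integral_sub (integrable_entropy_pair hη hη' hM hq ha hb ha' hb' (hv n) (hv2 n))
      (integrable_entropy_pair hη hη' hM hq ha hb ha' hb' hw hw2), ← Real.norm_eq_abs]
    refine (norm_integral_le_of_norm_le (g := fun z => Φ * M * (s * (1 + w z ^ 2)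
      + (2 + 2 / s) * (v n z - w z) ^ 2)) ?_ (Eventually.of_forall fun z =>
        abs_entropy_pair_sub_le hη hη' hM hq (ha' z) (hb' z) hs (v n z) (w z))).trans ?_
    · exact ((hone.const_mul s).add ((hsub n).const_mul _)).const_mul _
    · rw [integral_const_mul, integral_add (hone.const_mul s) ((hsub n).const_mul _),
        integral_const_mul, integral_const_mul]
  rw [Metric.tendsto_nhds]
  intro δ hδ
  set s : ℝ := δ / (2 * (Φ * M * A + 1)) with hs
  have hs0 : 0 < s := by positivity
  have hsA : Φ * M * A * s ≤ δ / 2 := by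
    rw [hs, mul_div_assoc', div_le_div_iff₀ (by positivity) two_pos]
    nlinarith
  have hlim := hvw.const_mul (Φ * M * (2 + 2 / s))
  rw [mul_zero] at hlim
  filter_upwards [hlim.eventually_lt_const (half_pos hδ)] with n hn
  rw [Real.dist_eq]
  have := hest n s hs0
  nlinarith

end Entropy

lemma setIntegral_rectangle_eq {F : ℝ → ℝ → ℝ} {a T r : ℝ} (ha : 0 ≤ a) (haT : a ≤ T) (hr : 0 ≤ r)
    (hF : IntegrableOn (fun z : ℝ × ℝ => F z.1 z.2) (Icc a T ×ˢ Icc (-r) r))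
    (h0 : ∀ t x, t ∉ Ioc a T ∨ x ∉ Ioc (-r) r → F t x = 0) :
    ∫ z in Icc a T ×ˢ Icc (-r) r, F z.1 z.2 = ∫ t in (0 : ℝ)..T, ∫ x in (-r)..r, F t x ∧
      ∫ z in Icc a T ×ˢ Icc (-r) r, F z.1 z.2 = ∫ t in Ioi (0 : ℝ), ∫ x, F t x := by
  have hinner : ∀ t, ∫ x in Icc (-r) r, F t x = ∫ x in (-r)..r, F t x := fun t => by
    rw [integral_Icc_eq_integral_Ioc, intervalIntegral.integral_of_le (by linarith)]
  have hline : ∀ t, ∫ x in (-r)..r, F t x = ∫ x, F t x := fun t => by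
    rw [intervalIntegral.integral_of_le (by linarith)]
    exact setIntegral_eq_integral_of_forall_compl_eq_zero fun x hx => h0 t x (.inr hx)
  have hrect : ∫ z in Icc a T ×ˢ Icc (-r) r, F z.1 z.2
      = ∫ t in Ioc a T, ∫ x in (-r)..r, F t x := by
    rw [Measure.volume_eq_prod] at hF ⊢
    rw [setIntegral_prod _ hF, integral_Icc_eq_integral_Ioc]
    simp only [hinner]
  have hzero : ∀ t, t ∉ Ioc a T → ∫ x in (-r)..r, F t x = 0 := fun t ht => by
    simp [h0 t _ (.inl ht)]
  constructor
  · rw [hrect, intervalIntegral.integral_of_le (ha.trans haT)]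
    exact (setIntegral_eq_of_subset_of_forall_sdiff_eq_zero measurableSet_Ioc
      (Ioc_subset_Ioc_left ha) fun t ht => hzero t ht.2).symm
  · simp only [← hline]
    rw [hrect]
    exact (setIntegral_eq_of_subset_of_forall_sdiff_eq_zero measurableSet_Ioi
      (fun t ht => ha.trans_lt ht.1) fun t ht => hzero t ht.2).symm

/-- The strong limit of the Rosenau–KdV–RLW approximations satisfies the
entropy inequality. -/
theorem limit_satisfies_entropy_inequality_KdVRLW
    (C0 D : ℝ) (hC0 : 0 < C0) (hD : 0 < D)
    (εs βs : ℕ → ℝ) (hεpos : ∀ n, 0 < εs n) (hβpos : ∀ n, 0 < βs n)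
    (hε0 : Tendsto εs atTop (nhds 0)) (hβ0 : Tendsto βs atTop (nhds 0))
    (hscale : ∀ n, βs n ≤ D ^ 2 * (εs n) ^ 4)
    (un : ℕ → ℝ → ℝ → ℝ)
    (hadm : ∀ n, IsAdmissibleKdVRLW (εs n) (βs n) (un n))
    (hdb : ∀ n, DataBoundsKdVRLW (εs n) (βs n) C0 (un n 0))
    (u : ℝ → ℝ → ℝ) (hbdd : BddL2L4 u)
    (hconv : ∀ p : ℝ, 1 ≤ p → p < 4 → ∀ a b r : ℝ, 0 < a → 0 < r →
      Tendsto (fun n => ∫ t in Set.Icc a b, ∫ x in Set.Icc (-r) r,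
        |un n t x - u t x| ^ p) atTop (nhds 0))
    (hae : ∀ᵐ q ∂((volume : Measure (ℝ × ℝ)).restrict
        ((Set.Ioi (0 : ℝ)) ×ˢ (Set.univ : Set ℝ))),
      Tendsto (fun n => un n q.1 q.2) atTop (nhds (u q.1 q.2))) :
    ∀ η : ℝ → ℝ, ContDiff ℝ 2 η → ConvexOn ℝ Set.univ η →
      (∃ M : ℝ, ∀ v : ℝ, |deriv η v| ≤ M) →
      (∃ M : ℝ, ∀ v : ℝ, |iteratedDeriv 2 η v| ≤ M) →
      ∀ q : ℝ → ℝ, (∀ v : ℝ, q v = ∫ ξ in (0 : ℝ)..v, 2 * ξ * deriv η ξ) →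
        ∀ φ : ℝ → ℝ → ℝ, ContDiff ℝ (⊤ : ℕ∞) (fun p : ℝ × ℝ => φ p.1 p.2) →
          HasCompactSupport (fun p : ℝ × ℝ => φ p.1 p.2) →
          tsupport (fun p : ℝ × ℝ => φ p.1 p.2) ⊆ (Set.Ioi (0 : ℝ)) ×ˢ (Set.univ : Set ℝ) →
          (∀ t x : ℝ, 0 ≤ φ t x) →
          0 ≤ ∫ t in Set.Ioi (0 : ℝ), ∫ x : ℝ,
                (η (u t x) * deriv (fun s => φ s x) t
                  + q (u t x) * deriv (fun y => φ t y) x) := by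
  intro η hη hηc ⟨M₁, h₁⟩ ⟨M₂, h₂⟩ q hq φ hφ hφc hφs hφ0
  obtain ⟨a, T, r, Φ, ha, haT, hr, hφt, hφa⟩ := exists_isTestFunction hφ hφc hφs hφ0
  have hT : 0 < T := ha.trans haT
  have hΦ : 0 ≤ Φ := (abs_nonneg _).trans (hφt.bound 0 0 (by norm_num) 0 0)
  set R : Set (ℝ × ℝ) := Icc a T ×ˢ Icc (-r) r with hR
  have hRc : IsCompact R := isCompact_Icc.prod isCompact_Icc
  have : IsFiniteMeasure (volume.restrict R) := ⟨by
    rw [Measure.restrict_apply_univ]; exact hRc.measure_lt_top⟩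
  have hηd : Differentiable ℝ η := hη.differentiable (by norm_num)
  have hη' : Continuous (deriv η) := hη.continuous_deriv (by norm_num)
  have hunc : ∀ n, Continuous fun z : ℝ × ℝ => un n z.1 z.2 := fun n => (hadm n).smooth.continuous
  have hunm : ∀ n, AEStronglyMeasurable (fun z : ℝ × ℝ => un n z.1 z.2) (volume.restrict R) :=
    fun n => (hunc n).aestronglyMeasurable
  have hun2 : ∀ n, Integrable (fun z : ℝ × ℝ => un n z.1 z.2 ^ 2) (volume.restrict R) :=
    fun n => ((hunc n).pow 2).continuousOn.integrableOn_compact hRc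
  have haeR : ∀ᵐ z ∂(volume.restrict R),
      Tendsto (fun n => un n z.1 z.2) atTop (nhds (u z.1 z.2)) :=
    ae_mono (Measure.restrict_mono (show R ⊆ Ioi (0 : ℝ) ×ˢ univ from
      fun z hz => ⟨ha.trans_le hz.1.1, mem_univ _⟩) le_rfl) hae
  have hum : AEStronglyMeasurable (fun z : ℝ × ℝ => u z.1 z.2) (volume.restrict R) :=
    aestronglyMeasurable_of_tendsto_ae atTop hunm haeR
  obtain ⟨C, hC, ε₀, hε₀, hub⟩ := exists_uniformBounds hC0 hD
  have hu2 : Integrable (fun z : ℝ × ℝ => u z.1 z.2 ^ 2) (volume.restrict R) := by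
    refine integrable_sq_of_tendsto_ae (C := C * volume.real (Icc a T)) hunm haeR hun2 ?_
    filter_upwards [hε0.eventually_lt_const hε₀] with n hn
    have hb := (hub (εs n) (βs n) (un n) (hεpos n) hn (hβpos n) (hscale n) (hadm n) (hdb n)
      T hT r hr).slice
    have hi := hun2 n
    rw [Measure.volume_eq_prod] at hi ⊢
    rw [setIntegral_prod _ hi]
    refine (le_abs_self _).trans ?_
    rw [← Real.norm_eq_abs]
    refine norm_setIntegral_le_of_norm_le_const measure_Icc_lt_top fun t ht => ?_
    have := hb t ⟨ha.le.trans ht.1, ht.2⟩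
    rw [mixedD_zero_zero, intervalIntegral.integral_of_le (by linarith),
      ← integral_Icc_eq_integral_Ioc] at this
    rwa [Real.norm_eq_abs, abs_of_nonneg (integral_nonneg fun x => sq_nonneg _)]
  have hL2 : Tendsto (fun n => ∫ z, (un n z.1 z.2 - u z.1 z.2) ^ 2 ∂(volume.restrict R))
      atTop (nhds 0) := by
    refine (hconv 2 (by norm_num) (by norm_num) a T r ha hr).congr fun n => ?_
    have hi : IntegrableOn (fun z : ℝ × ℝ => (un n z.1 z.2 - u z.1 z.2) ^ 2) R := by
      refine (((hun2 n).const_mul 2).add (hu2.const_mul 2)).mono' (((hunm n).sub hum).pow 2)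
        (Eventually.of_forall fun z => ?_)
      rw [Real.norm_eq_abs, abs_of_nonneg (by positivity)]
      change _ ≤ 2 * un n z.1 z.2 ^ 2 + 2 * u z.1 z.2 ^ 2
      nlinarith [sq_nonneg (un n z.1 z.2 + u z.1 z.2)]
    rw [Measure.volume_eq_prod] at hi ⊢
    rw [setIntegral_prod _ hi]
    simp only [Real.rpow_two, sq_abs]
  have hφm : ∀ j k, AEStronglyMeasurable (fun z : ℝ × ℝ => mixedD φ j k z.1 z.2)
      (volume.restrict R) := fun j k => (continuous_mixedD hφ j k).aestronglyMeasurable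
  have hb₁ : ∀ z : ℝ × ℝ, |mixedD φ 1 0 z.1 z.2| ≤ Φ :=
    fun z => hφt.bound 1 0 (by norm_num) z.1 z.2
  have hb₂ : ∀ z : ℝ × ℝ, |mixedD φ 0 1 z.1 z.2| ≤ Φ :=
    fun z => hφt.bound 0 1 (by norm_num) z.1 z.2
  have hlim := tendsto_integral_entropy_pair hηd hη' h₁ hq hΦ (hφm 1 0) (hφm 0 1) hb₁ hb₂
    hunm hun2 hum hu2 hL2
  have hvanish : ∀ j k t x, t ∉ Ioc a T ∨ x ∉ Ioc (-r) r → mixedD φ j k t x = 0 := by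
    intro j k t x h
    by_cases hta : t ≤ a
    · exact hφa j k t x hta
    · refine hφt.eq_zero j k t x (h.imp (fun h h' => h ⟨not_le.1 hta, h'.2.le⟩)
        fun h h' => h ⟨h'.1, h'.2.le⟩)
  have hrect : ∀ v : ℝ → ℝ → ℝ,
      AEStronglyMeasurable (fun z : ℝ × ℝ => v z.1 z.2) (volume.restrict R) →
      Integrable (fun z : ℝ × ℝ => v z.1 z.2 ^ 2) (volume.restrict R) → _ := fun v hv hv2 =>
    setIntegral_rectangle_eq (F := fun t x => η (v t x) * mixedD φ 1 0 t x
      + q (v t x) * mixedD φ 0 1 t x) ha.le haT.le hr.le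
      (integrable_entropy_pair hηd hη' h₁ hq (hφm 1 0) (hφm 0 1) hb₁ hb₂ hv hv2)
      fun t x h => by simp [hvanish _ _ t x h]
  have hgoal : ∀ t x, η (u t x) * deriv (fun s => φ s x) t + q (u t x) * deriv (fun y => φ t y) x
      = η (u t x) * mixedD φ 1 0 t x + q (u t x) * mixedD φ 0 1 t x := fun t x => by
    rw [mixedD_succ_left, mixedD_zero_succ, mixedD_zero_zero]
  simp only [hgoal]
  rw [← (hrect u hum hu2).2]
  refine le_of_forall_pos_le_add fun δ hδ => ?_
  have hev := eventually_entropy_production_ge hC0 hD hεpos hβpos hε0 hscale hadm hdb hη hηc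
    h₁ h₂ hq hφt hT hr hδ
  have := ge_of_tendsto hlim (b := -δ) (hev.mono fun n hn => by
    rw [(hrect (un n) (hunm n) (hun2 n)).1]
    simpa only [mixedD_zero_zero] using hn)
  linarith

end
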